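/- Let (ρ, β): (A, d, h) → (A', d', h') be a morphism of curved differential Γ-graded algebras over a field k. Then the induced map (ρ,β)_* on reduced Hochschild complexes of the second kind, defined by (ρ,β)_*(a₀[ā₁|⋯|āₙ]) = Σ_{i₀,…,iₙ≥0} (−1)^{i₀+⋯+iₙ} ρ(a₀)[β̄^{i₀}|ρ(a₁)̄|β̄^{i₁}|⋯|ρ(aₙ)̄|β̄^{iₙ}] (β^{i} denoting i consecutive entries β), commutes with both the Hochschild differential b and the Connes operator B; that is, (ρ,β)_*: (H̄och^{II}(A,d,h), b, B) → (H̄och^{II}(A',d',h'), b, B) is a morphism of mixed complexes. If β = 0 (a strict morphism), the same holds for the direct-sum reduced complexes (H̄och(A,d,h), b, B) → (H̄och(A',d',h'), b, B). -/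

import Mathlib

noncomputable section

open Finset

/-- The grading group `Γ` (to be thought of as `ℤ` or `ℤ/2ℤ`): an additive
commutative group with one, together with its parity homomorphism to `ℤ/2ℤ`
(through which all Koszul signs are computed). -/
class GradingGroup (Γ : Type) extends AddCommGroupWithOne Γ where
  parity : Γ →+ ZMod 2
  parity_one : parity 1 = 1

/-- The Koszul sign `(−1)^{|γ|}` in `k`. -/
def gsign (k : Type) [Field k] {Γ : Type} [GradingGroup Γ] (γ : Γ) : k :=
  (-1 : k) ^ (GradingGroup.parity γ).val

/-- The Koszul sign `(−1)^{|γ|·|γ'|}` in `k`. -/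
def gsign2 (k : Type) [Field k] {Γ : Type} [GradingGroup Γ] (γ γ' : Γ) : k :=
  (-1 : k) ^ (GradingGroup.parity γ * GradingGroup.parity γ').val

/-- `degSum g j = g 0 + ⋯ + g (j-1)` : the sum of the first `j` degrees. -/
def degSum {Γ : Type} [GradingGroup Γ] (g : ℕ → Γ) (j : ℕ) : Γ :=
  ∑ t ∈ Finset.range j, g t

/-- Read a sequence cyclically with period `m + 1`. -/
def cyc {α : Type} (m : ℕ) (X : ℕ → α) : ℕ → α := fun i => X (i % (m + 1))

/-- Contract a chain at position `j`, multiplying the `j`-th and `(j+1)`-st entries. -/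
def contractChain {E : Type} [Mul E] (a : ℕ → E) (j : ℕ) : ℕ → E :=
  fun i => if i < j then a i else if i = j then a j * a (j + 1) else a (i + 1)

/-- Omit the `(j+1)`-st term of a sequence of objects. -/
def dropIdx {α : Type} (X : ℕ → α) (j : ℕ) : ℕ → α :=
  fun i => if i ≤ j then X i else X (i + 1)

/-- Insert `x` into a chain after position `j`. -/
def insertChain {E : Type} (a : ℕ → E) (j : ℕ) (x : E) : ℕ → E :=
  fun i => if i ≤ j then a i else if i = j + 1 then x else a (i - 1)

/-- Insert `x` into a chain so that it occupies position `j`. -/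
def insertAt {E : Type} (a : ℕ → E) (j : ℕ) (x : E) : ℕ → E :=
  fun i => if i < j then a i else if i = j then x else a (i - 1)

/-- Duplicate the `(j+1)`-st term of a sequence of objects. -/
def dupIdx {α : Type} (X : ℕ → α) (j : ℕ) : ℕ → α :=
  fun i => if i ≤ j + 1 then X i else X (i - 1)

/-- The ordered product `f 0 * f 1 * ⋯ * f m`. -/
def chainProd {E : Type} [Mul E] (f : ℕ → E) : ℕ → E
  | 0 => f 0
  | m + 1 => chainProd f m * f (m + 1)

/-- Extend a `Fin (n+1)`-tuple of naturals by zero. -/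
def extTuple {n : ℕ} (v : Fin (n + 1) → ℕ) : ℕ → ℕ :=
  fun t => if h : t < n + 1 then v ⟨t, h⟩ else 0


/-- A curved differential `Γ`-graded algebra `(A, d, h)` over `k`: a unital `Γ`-graded
`k`-algebra `A` with a degree-one `k`-linear derivation `d` and a degree-two curvature
element `h` satisfying `d² = [h,−]` and `d(h) = 0`. -/
structure CurvedDGA (k Γ : Type) [Field k] [GradingGroup Γ] where
  A : Type
  [ringA : Ring A]
  [algA : Algebra k A]
  deg : Γ → Submodule k A
  one_mem : (1 : A) ∈ deg 0
  mul_mem : ∀ {γ γ' : Γ} {a b : A}, a ∈ deg γ → b ∈ deg γ' → a * b ∈ deg (γ + γ')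
  d : A →ₗ[k] A
  hEl : A
  d_deg : ∀ {γ : Γ} {a : A}, a ∈ deg γ → d a ∈ deg (γ + 1)
  d_leibniz : ∀ {γ : Γ} {a : A}, a ∈ deg γ → ∀ b : A,
      d (a * b) = d a * b + gsign k γ • (a * d b)
  h_deg : hEl ∈ deg 2
  d_sq : ∀ a : A, d (d a) = hEl * a - a * hEl
  d_h : d hEl = 0

attribute [instance] CurvedDGA.ringA CurvedDGA.algA

variable {k Γ : Type} [Field k] [GradingGroup Γ]

/-- Each `a i` (for `i ≤ n`) is homogeneous of degree `g i`. -/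
def CurvedDGA.Homog (R : CurvedDGA k Γ) (n : ℕ) (g : ℕ → Γ) (a : ℕ → R.A) : Prop :=
  ∀ i ≤ n, a i ∈ R.deg (g i)

/-- A model of the weight components of the reduced Hochschild complexes of a cdga
`R = (A, d, h)`: `W n` models `A ⊗ (ΣĀ)^{⊗n}`, `gen n a` models the chain
`a₀[ā₁|⋯|āₙ]`, and the operators `b₂, b₁, b₀` and the Connes operator `B` satisfy
their defining formulas (with Koszul signs) on homogeneous chains.
`H̄och(R) = ⊕ₙ Wₙ` and `H̄och^{II}(R) = ∏ₙ Wₙ`. -/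
structure RedAlgHochParts (k Γ : Type) [Field k] [GradingGroup Γ] (R : CurvedDGA k Γ) where
  W : ℕ → Type
  [addW : ∀ n, AddCommGroup (W n)]
  [modW : ∀ n, Module k (W n)]
  gen : (n : ℕ) → (ℕ → R.A) → W n
  gen_ext : ∀ {n : ℕ} {a a' : ℕ → R.A}, (∀ i ≤ n, a i = a' i) → gen n a = gen n a'
  gen_add : ∀ (n : ℕ) (a : ℕ → R.A) (i : ℕ), i ≤ n → ∀ x y : R.A,
      gen n (Function.update a i (x + y)) =
        gen n (Function.update a i x) + gen n (Function.update a i y)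
  gen_smul : ∀ (n : ℕ) (a : ℕ → R.A) (i : ℕ), i ≤ n → ∀ (c : k) (x : R.A),
      gen n (Function.update a i (c • x)) = c • gen n (Function.update a i x)
  span_gen : ∀ n : ℕ, Submodule.span k
      {w : W n | ∃ a g, R.Homog n g a ∧ w = gen n a} = ⊤
  gen_reduced : ∀ (n : ℕ) (a : ℕ → R.A) (i : ℕ), 1 ≤ i → i ≤ n → a i = 1 → gen n a = 0
  b2 : (n : ℕ) → W (n + 1) →ₗ[k] W n
  b1 : (n : ℕ) → W n →ₗ[k] W n
  b0 : (n : ℕ) → W n →ₗ[k] W (n + 1)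
  Bop : (n : ℕ) → W n →ₗ[k] W (n + 1)
  b2_gen : ∀ (n : ℕ) (a : ℕ → R.A) (g : ℕ → Γ), R.Homog (n + 1) g a →
      b2 n (gen (n + 1) a) =
        (∑ j ∈ Finset.range (n + 1), gsign k (degSum g (j + 1) - (j : Γ)) •
            gen n (contractChain a j))
        - gsign2 k (g (n + 1) - 1) (degSum g (n + 1) - (n : Γ)) •
            gen n (fun i => if i = 0 then a (n + 1) * a 0 else a i)
  b1_gen : ∀ (n : ℕ) (a : ℕ → R.A) (g : ℕ → Γ), R.Homog n g a →
      b1 n (gen n a) = ∑ j ∈ Finset.range (n + 1),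
          gsign k (degSum g j - (j : Γ)) • gen n (Function.update a j (R.d (a j)))
  b0_gen : ∀ (n : ℕ) (a : ℕ → R.A) (g : ℕ → Γ), R.Homog n g a →
      b0 n (gen n a) = ∑ j ∈ Finset.range (n + 1),
          gsign k (degSum g (j + 1) - (j : Γ)) • gen (n + 1) (insertChain a j R.hEl)
  Bop_gen : ∀ (n : ℕ) (a : ℕ → R.A) (g : ℕ → Γ), R.Homog n g a →
      Bop n (gen n a) = ∑ l ∈ Finset.range (n + 1),
        gsign2 k ((∑ t ∈ Finset.Ico l (n + 1), g t) - ((n - l + 1 : ℕ) : Γ))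
                 (degSum g l - (l : Γ)) •
          gen (n + 1) (fun i => if i = 0 then 1 else a ((l + i - 1) % (n + 1)))

attribute [instance] RedAlgHochParts.addW RedAlgHochParts.modW

variable {R : CurvedDGA k Γ}

/-- The total Hochschild differential `b = b₂ + b₁ + b₀` on `H̄och^{II}(R) = ∏ₙ Wₙ`. -/
def RedAlgHochParts.bTot (H : RedAlgHochParts k Γ R) (x : ∀ n, H.W n) : ∀ n, H.W n :=
  fun n => H.b2 n (x (n + 1)) + H.b1 n (x n) +
    (match n with
      | 0 => 0
      | m + 1 => H.b0 m (x m))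

/-- The total Connes operator `B` on `H̄och^{II}(R) = ∏ₙ Wₙ`. -/
def RedAlgHochParts.BTot (H : RedAlgHochParts k Γ R) (x : ∀ n, H.W n) : ∀ n, H.W n :=
  fun n =>
    (match n with
      | 0 => 0
      | m + 1 => H.Bop m (x m))

/-- The interleaved chain `ρ(a₀)[β^{i₀}|ρ(a₁)|β^{i₁}|⋯|ρ(aₙ)|β^{iₙ}]`: position
`t + v 0 + ⋯ + v (t-1)` carries `ρ(a t)`, and all other positions carry `β`. -/
def interleave {A' : Type} (b : A') (f : ℕ → A') (v : ℕ → ℕ) (n : ℕ) : ℕ → A' :=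
  fun p =>
    if h : ∃ t, t ≤ n ∧ t + (∑ s ∈ Finset.range t, v s) = p then f h.choose else b

namespace RedAlgHochParts

section InsertionSums

variable {E E' X Y : Type} [AddCommGroup X] [AddCommGroup Y]

/-- The signed sum `∑ (-1)^i φ(w)` over the words `w` of length `m` obtained from `l` by
inserting `i` copies of the letter `b` at arbitrary places. -/
def insSum (b : E) : ℕ → (List E → X) → List E → X
  | 0, φ, [] => φ []
  | 0, _, _ :: _ => 0
  | m + 1, φ, [] => -insSum b m (fun w => φ (b :: w)) []
  | m + 1, φ, x :: l =>
      insSum b m (fun w => φ (x :: w)) l - insSum b m (fun w => φ (b :: w)) (x :: l)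

lemma insSum_comp (b : E) (f : X →+ Y) (m : ℕ) (φ : List E → X) (l : List E) :
    insSum b m (fun w => f (φ w)) l = f (insSum b m φ l) := by
  induction m generalizing φ l with
  | zero => cases l <;> simp [insSum]
  | succ m ih => cases l <;> simp [insSum, ih]

lemma insSum_add (b : E) (m : ℕ) (φ ψ : List E → X) (l : List E) :
    insSum b m (fun w => φ w + ψ w) l = insSum b m φ l + insSum b m ψ l := by
  induction m generalizing φ ψ l with
  | zero => cases l <;> simp [insSum]
  | succ m ih => cases l <;> simp only [insSum, ih] <;> abel

lemma insSum_neg (b : E) (m : ℕ) (φ : List E → X) (l : List E) :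
    insSum b m (fun w => -φ w) l = -insSum b m φ l :=
  insSum_comp b (-AddMonoidHom.id X) m φ l

lemma insSum_sub (b : E) (m : ℕ) (φ ψ : List E → X) (l : List E) :
    insSum b m (fun w => φ w - ψ w) l = insSum b m φ l - insSum b m ψ l := by
  simp only [sub_eq_add_neg, insSum_add, insSum_neg]

lemma insSum_zero (b : E) (m : ℕ) (l : List E) :
    insSum b m (fun _ => (0 : X)) l = 0 :=
  insSum_comp b (0 : X →+ X) m (fun _ => 0) l

lemma insSum_smul [Module k X] (b : E) (m : ℕ) (c : k) (φ : List E → X) (l : List E) :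
    insSum b m (fun w => c • φ w) l = c • insSum b m φ l :=
  insSum_comp b (DistribSMul.toAddMonoidHom X c) m φ l

lemma insSum_map (f : E → E') (b : E) (m : ℕ) (φ : List E' → X) (l : List E) :
    insSum (f b) m φ (l.map f) = insSum b m (fun w => φ (w.map f)) l := by
  induction m generalizing φ l with
  | zero => cases l <;> simp [insSum]
  | succ m ih =>
    cases l with
    | nil => simpa [insSum] using ih (fun w => φ (f b :: w)) []
    | cons x l =>
      have h := ih (fun w => φ (f b :: w)) (x :: l)
      simp only [List.map_cons] at h
      simp [insSum, ih, h]

lemma insSum_of_lt (b : E) (m : ℕ) (φ : List E → X) (l : List E) (h : m < l.length) :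
    insSum b m φ l = 0 := by
  induction m generalizing φ l with
  | zero => cases l <;> simp_all [insSum]
  | succ m ih =>
    cases l with
    | nil => simp at h
    | cons x l =>
      rw [insSum, ih _ l (by simpa using h), ih _ (x :: l) (by omega), sub_zero]

/-- Two functionals have the same insertion sum as soon as they agree on the words of the
right length whose letters satisfy `q` and whose total weight is that of the given word. -/
lemma insSum_congr {M : Type} [AddCommMonoid M] (b : E) (q : E → Prop) (hb : q b)
    (s : E → M) (sb : s b = 0) (m : ℕ) (φ ψ : List E → X) (l : List E) (hl : ∀ x ∈ l, q x)
    (h : ∀ w : List E, w.length = m → (∀ x ∈ w, q x) →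
      (w.map s).sum = (l.map s).sum → φ w = ψ w) :
    insSum b m φ l = insSum b m ψ l := by
  induction m generalizing φ ψ l with
  | zero =>
    cases l with
    | nil => exact h [] rfl hl rfl
    | cons x l => rfl
  | succ m ih =>
    have key : insSum b m (fun w => φ (b :: w)) l = insSum b m (fun w => ψ (b :: w)) l := by
      refine ih _ _ l hl fun w hw hq hs => h (b :: w) (by simp [hw]) ?_ (by simp [sb, hs])
      simpa [hb] using hq
    cases l with
    | nil => simp only [insSum, key]
    | cons x l =>
      simp only [insSum, key]
      congr 1
      simp only [List.mem_cons, forall_eq_or_imp] at hl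
      refine ih _ _ l hl.2 fun w hw hq hs => h (x :: w) (by simp [hw]) ?_ (by simp [hs])
      simpa [hl.1] using hq

lemma insSum_comm (b : E) (b' : E') (m m' : ℕ) (Φ : List E → List E' → X)
    (l : List E) (l' : List E') :
    insSum b m (fun u => insSum b' m' (fun v => Φ u v) l') l =
      insSum b' m' (fun v => insSum b m (fun u => Φ u v) l) l' := by
  induction m generalizing Φ l with
  | zero =>
    cases l with
    | nil => rfl
    | cons x l => simp [insSum, insSum_zero]
  | succ m ih =>
    cases l with
    | nil => simp [insSum, ih, insSum_neg]
    | cons x l => simp [insSum, ih, insSum_sub]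

lemma insSum_nil_right (b : E) (m : ℕ) (φ : List E → X) :
    insSum b (m + 1) φ [] = -insSum b m (fun w => φ (w ++ [b])) [] := by
  induction m generalizing φ with
  | zero => simp [insSum]
  | succ m ih =>
    rw [insSum, ih]
    simp [insSum]

lemma insSum_append_right (b : E) (m : ℕ) (φ : List E → X) (l : List E) (y : E) :
    insSum b (m + 1) φ (l ++ [y]) =
      insSum b m (fun w => φ (w ++ [y])) l - insSum b m (fun w => φ (w ++ [b])) (l ++ [y]) := by
  induction m generalizing φ l with
  | zero =>
    cases l with
    | nil => simp [insSum]
    | cons x l => cases l <;> simp [insSum]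
  | succ m ih =>
    cases l with
    | nil =>
      have h := ih (fun w => φ (b :: w)) []
      simp only [List.nil_append] at h
      change insSum b (m + 1) (fun w => φ (y :: w)) [] -
        insSum b (m + 1) (fun w => φ (b :: w)) [y] = _
      rw [h, insSum_nil_right]
      simp only [List.nil_append, insSum, List.cons_append]
      abel
    | cons x l =>
      rw [List.cons_append, insSum, ih, ← List.cons_append, ih]
      simp only [insSum, List.cons_append]
      abel

/-- The signed sum over insertions into two words, of total length `m`. -/
def insSum₂ (b : E) (m : ℕ) (Φ : List E → List E → X) (l₁ l₂ : List E) : X :=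
  ∑ p ∈ antidiagonal m, insSum b p.1 (fun u => insSum b p.2 (fun v => Φ u v) l₂) l₁

lemma insSum₂_zero_cons (b : E) (Φ : List E → List E → X) (x : E) (l₁ l₂ : List E) :
    insSum₂ b 0 Φ (x :: l₁) l₂ = 0 := by
  simp [insSum₂, insSum]

lemma insSum₂_succ_nil (b : E) (m : ℕ) (Φ : List E → List E → X) (l₂ : List E) :
    insSum₂ b (m + 1) Φ [] l₂ =
      insSum b (m + 1) (Φ []) l₂ - insSum₂ b m (fun u v => Φ (b :: u) v) [] l₂ := by
  simp [insSum₂, Finset.Nat.sum_antidiagonal_succ, insSum, sub_eq_add_neg]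

lemma insSum₂_succ_cons (b : E) (m : ℕ) (Φ : List E → List E → X) (x : E) (l₁ l₂ : List E) :
    insSum₂ b (m + 1) Φ (x :: l₁) l₂ =
      insSum₂ b m (fun u v => Φ (x :: u) v) l₁ l₂
        - insSum₂ b m (fun u v => Φ (b :: u) v) (x :: l₁) l₂ := by
  simp [insSum₂, Finset.Nat.sum_antidiagonal_succ, insSum]

lemma insSum₂_swap (b : E) (m : ℕ) (Φ : List E → List E → X) (l₁ l₂ : List E) :
    insSum₂ b m Φ l₁ l₂ = insSum₂ b m (fun v u => Φ u v) l₂ l₁ := by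
  unfold insSum₂
  rw [← Finset.Nat.sum_antidiagonal_swap]
  exact Finset.sum_congr rfl fun p _ => insSum_comm ..

lemma insSum_append_cons (b : E) (m : ℕ) (φ : List E → X) (a : E) (l₁ l₂ : List E) :
    insSum b (m + 1) φ (l₁ ++ a :: l₂) = insSum₂ b m (fun u v => φ (u ++ a :: v)) l₁ l₂ := by
  induction m generalizing φ l₁ with
  | zero =>
    cases l₁ with
    | nil => simp [insSum₂, insSum]
    | cons x l => cases l <;> simp [insSum₂_zero_cons, insSum]
  | succ m ih =>
    cases l₁ with
    | nil =>
      have h := ih (fun w => φ (b :: w)) []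
      simp only [List.nil_append] at h
      rw [insSum₂_succ_nil, List.nil_append, insSum, h]
      rfl
    | cons x l =>
      have h := ih (fun w => φ (b :: w)) (x :: l)
      simp only [List.cons_append] at h
      rw [insSum₂_succ_cons, List.cons_append, insSum, h, ih]
      rfl

/-- The sum of `Ψ u v` over all the ways to cut a word as `u ++ v`. -/
def splitSum (Ψ : List E → List E → X) : List E → X
  | [] => Ψ [] []
  | x :: w => Ψ [] (x :: w) + splitSum (fun u v => Ψ (x :: u) v) w

lemma splitSum_congr (Ψ Φ : List E → List E → X) (w : List E)
    (h : ∀ u v, u ++ v = w → Ψ u v = Φ u v) : splitSum Ψ w = splitSum Φ w := by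
  induction w generalizing Ψ Φ with
  | nil => exact h [] [] rfl
  | cons x w ih =>
    rw [splitSum, splitSum, h [] (x :: w) rfl]
    congr 1
    exact ih _ _ fun u v huv => h _ _ (by simp [huv])

lemma splitSum_sub (Ψ Φ : List E → List E → X) (w : List E) :
    splitSum (fun u v => Ψ u v - Φ u v) w = splitSum Ψ w - splitSum Φ w := by
  induction w generalizing Ψ Φ with
  | nil => rfl
  | cons x w ih => simp only [splitSum, ih]; abel

lemma splitSum_comp (f : X →+ Y) (Ψ : List E → List E → X) (w : List E) :
    f (splitSum Ψ w) = splitSum (fun u v => f (Ψ u v)) w := by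
  induction w generalizing Ψ with
  | nil => rfl
  | cons x w ih => simp only [splitSum, map_add, ih]

lemma splitSum_map (f : E → E') (Ψ : List E' → List E' → X) (w : List E) :
    splitSum Ψ (w.map f) = splitSum (fun u v => Ψ (u.map f) (v.map f)) w := by
  induction w generalizing Ψ with
  | nil => rfl
  | cons x w ih => simp only [splitSum, List.map_cons, ih]; rfl

lemma splitSum_eq_sum (Ψ : List E → List E → X) (w : List E) :
    splitSum Ψ w = ∑ i ∈ range (w.length + 1), Ψ (w.take i) (w.drop i) := by
  induction w generalizing Ψ with
  | nil => simp [splitSum]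
  | cons x w ih =>
    rw [splitSum, ih, List.length_cons, Finset.sum_range_succ' _ (w.length + 1), add_comm]
    rfl

lemma insSum_splitSum (b : E) (m : ℕ) (Ψ : List E → List E → X) (l : List E) :
    insSum b m (splitSum Ψ) l = splitSum (insSum₂ b m Ψ) l := by
  induction m generalizing Ψ l with
  | zero =>
    cases l with
    | nil => simp [splitSum, insSum₂, insSum]
    | cons x l =>
      have : splitSum (fun u v => insSum₂ b 0 Ψ (x :: u) v) l = 0 := by
        simp only [insSum₂_zero_cons]
        exact (splitSum_comp (0 : X →+ X) (fun _ _ => 0) l).symm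
      rw [splitSum, this]
      simp [insSum, insSum₂]
  | succ m ih =>
    cases l with
    | nil =>
      simp only [insSum, splitSum, insSum₂_succ_nil, insSum_add, ih]
      abel
    | cons x l =>
      simp only [insSum, splitSum, insSum₂_succ_nil, insSum₂_succ_cons, insSum_add, ih,
        splitSum_sub]
      abel

/-- The word `b^{v 0} x₁ b^{v 1} ⋯ xₙ b^{v n}`. -/
def blockWord (b : E) (v : ℕ → ℕ) : List E → List E
  | [] => List.replicate (v 0) b
  | x :: l => List.replicate (v 0) b ++ x :: blockWord b (fun i => v (i + 1)) l

lemma insSum_cons_eq_sum [Module k X] (b : E) (φ : List E → X) (x : E) (l : List E) (N : ℕ) :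
    insSum b (l.length + N + 1) φ (x :: l) = ∑ p ∈ antidiagonal N,
      (-1 : k) ^ p.1 • insSum b (l.length + p.2)
        (fun w => φ (List.replicate p.1 b ++ x :: w)) l := by
  induction N generalizing φ with
  | zero => simp [insSum, insSum_of_lt b l.length _ (x :: l) (by simp)]
  | succ N ih =>
    rw [insSum, ← add_assoc, ih, Finset.Nat.sum_antidiagonal_succ, sub_eq_add_neg,
      ← Finset.sum_neg_distrib]
    simp [pow_succ, List.replicate_succ, add_assoc]

lemma insSum_nil_eq [Module k X] (b : E) (φ : List E → X) (N : ℕ) :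
    insSum b N φ [] = (-1 : k) ^ N • φ (List.replicate N b) := by
  induction N generalizing φ with
  | zero => simp [insSum]
  | succ N ih => simp [insSum, ih, pow_succ, List.replicate_succ]

lemma sum_antidiagonalTuple_succ (n N : ℕ) (f : (Fin (n + 1) → ℕ) → X) :
    ∑ v ∈ Finset.Nat.antidiagonalTuple (n + 1) N, f v =
      ∑ p ∈ antidiagonal N, ∑ v ∈ Finset.Nat.antidiagonalTuple n p.2, f (Fin.cons p.1 v) := by
  rw [Finset.sum_sigma']
  refine Finset.sum_bij' (fun v _ => ⟨(v 0, ∑ i, Fin.tail v i), Fin.tail v⟩)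
    (fun s _ => Fin.cons s.1.1 s.2) ?_ ?_ ?_ ?_ ?_
  · intro v hv
    rw [Finset.Nat.mem_antidiagonalTuple, Fin.sum_univ_succ] at hv
    simp [Finset.Nat.mem_antidiagonalTuple, Fin.tail, hv]
  · rintro ⟨⟨i, j⟩, v⟩ hv
    simp only [Finset.mem_sigma, HasAntidiagonal.mem_antidiagonal,
      Finset.Nat.mem_antidiagonalTuple] at hv ⊢
    simp [Fin.sum_univ_succ, hv.1, hv.2]
  · intro v _
    simp
  · rintro ⟨⟨i, j⟩, v⟩ hv
    simp only [Finset.mem_sigma, HasAntidiagonal.mem_antidiagonal,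
      Finset.Nat.mem_antidiagonalTuple] at hv
    simp [hv.2]
  · intro v _
    simp

lemma extTuple_cons {n : ℕ} (i : ℕ) (v : Fin (n + 1) → ℕ) :
    extTuple (Fin.cons i v : Fin (n + 2) → ℕ) = fun t => Nat.casesOn t i (extTuple v) := by
  funext t
  cases t with
  | zero => simp [extTuple]
  | succ t =>
    by_cases h : t < n + 1
    · have h' : t + 1 < n + 1 + 1 := by omega
      simp only [extTuple, dif_pos h, dif_pos h']
      exact Fin.cons_succ (α := fun _ => ℕ) i v ⟨t, h⟩
    · have h' : ¬t + 1 < n + 1 + 1 := by omega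
      simp only [extTuple, dif_neg h, dif_neg h']

lemma insSum_eq_sum_blockWord [Module k X] (b : E) (φ : List E → X) (l : List E) (N : ℕ) :
    insSum b (l.length + N) φ l = (-1 : k) ^ N •
      ∑ v ∈ Finset.Nat.antidiagonalTuple (l.length + 1) N,
        φ (blockWord b (extTuple v) l) := by
  induction l generalizing φ N with
  | nil => simp [insSum_nil_eq (k := k), blockWord, extTuple]
  | cons x l ih =>
    rw [List.length_cons, add_right_comm, insSum_cons_eq_sum (k := k),
      sum_antidiagonalTuple_succ, Finset.smul_sum]
    refine Finset.sum_congr rfl fun p hp => ?_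
    rw [ih, smul_smul, ← pow_add, HasAntidiagonal.mem_antidiagonal.1 hp]
    simp only [extTuple_cons, blockWord]
    rfl

end InsertionSums

section Signs

lemma neg_one_pow_val_add (a b : ZMod 2) :
    (-1 : k) ^ (a + b).val = (-1) ^ a.val * (-1) ^ b.val := by
  rw [← pow_add, ZMod.val_add, neg_one_pow_eq_pow_mod_two, Nat.mod_mod,
    ← neg_one_pow_eq_pow_mod_two]

lemma gsign_add (a b : Γ) : gsign k (a + b) = gsign k a * gsign k b := by
  simp [gsign, neg_one_pow_val_add]

lemma gsign_zero : gsign k (0 : Γ) = 1 := by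
  simp [gsign]

lemma gsign_one : gsign k (1 : Γ) = -1 := by
  simp [gsign, GradingGroup.parity_one, ZMod.val_one]

lemma gsign_neg (a : Γ) : gsign k (-a) = gsign k a := by
  simp [gsign, ZMod.neg_eq_self_mod_two]

lemma gsign_sub_one (a : Γ) : gsign k (a - 1) = -gsign k a := by
  rw [sub_eq_add_neg, gsign_add, gsign_neg, gsign_one, mul_neg_one]

lemma gsign2_zero_left (a : Γ) : gsign2 k 0 a = 1 := by
  simp [gsign2]

lemma gsign2_zero_right (a : Γ) : gsign2 k a 0 = 1 := by
  simp [gsign2]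

end Signs

section BarOperators

variable {X : Type} [AddCommGroup X]

/-- The functional `ψ` evaluated on a word whose first two letters, the first being `x`,
have been multiplied. -/
def barMulHead (R : CurvedDGA k Γ) (ψ : List R.A → X) (x : Γ × R.A) : List (Γ × R.A) → X
  | [] => 0
  | y :: w => ψ (x.2 * y.2 :: w.map Prod.snd)

lemma barMulHead_sub (ψ φ : List R.A → X) (x : Γ × R.A) (w : List (Γ × R.A)) :
    barMulHead R (fun u => ψ u - φ u) x w = barMulHead R ψ x w - barMulHead R φ x w := by
  cases w <;> simp [barMulHead]

lemma barMulHead_zero (x : Γ × R.A) (w : List (Γ × R.A)) :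
    barMulHead R (fun _ => (0 : X)) x w = 0 := by
  cases w <;> rfl

/-- Insertion sums over the nonempty words beginning with the first letter of the given word. -/
def headSum {E : Type} (b : E) (m : ℕ) (ψ : List E → X) : List E → X
  | [] => 0
  | z :: w => insSum b m (fun u => ψ (z :: u)) w

lemma insSum_succ {E : Type} (b : E) (m : ℕ) (ψ : List E → X) (w : List E) :
    insSum b (m + 1) ψ w = headSum b m ψ w - insSum b m (fun u => ψ (b :: u)) w := by
  cases w <;> simp [insSum, headSum]

lemma insSum_map_snd {L A : Type} (b : L × A) (m : ℕ) (φ : List A → X) (l : List (L × A)) :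
    insSum b m (fun w => φ (w.map Prod.snd)) l = insSum b.2 m φ (l.map Prod.snd) :=
  (insSum_map Prod.snd b m φ l).symm

lemma insSum_barMulHead (ψ : List R.A → X) (b x : Γ × R.A) (m : ℕ) (l : List (Γ × R.A)) :
    insSum b (m + 1) (barMulHead R ψ x) l =
      barMulHead R (headSum b.2 m ψ) x l -
        insSum b.2 m (fun w => ψ (x.2 * b.2 :: w)) (l.map Prod.snd) := by
  rw [← insSum_map_snd b m (fun w => ψ (x.2 * b.2 :: w))]
  cases l <;> simp [insSum, barMulHead, headSum, ← insSum_map_snd]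

variable [Module k X]

/-- The transpose of the multiplicative part of the bar differential. -/
def barMul (R : CurvedDGA k Γ) : (List R.A → X) → List (Γ × R.A) → X
  | _, [] => 0
  | ψ, x :: w => gsign k (x.1 - 1) • (barMul R (fun u => ψ (x.2 :: u)) w + barMulHead R ψ x w)

/-- The transpose of the part of the bar differential given by `-d`. -/
def barD (R : CurvedDGA k Γ) : (List R.A → X) → List (Γ × R.A) → X
  | _, [] => 0
  | ψ, x :: w =>
      gsign k (x.1 - 1) • barD R (fun u => ψ (x.2 :: u)) w - ψ (R.d x.2 :: w.map Prod.snd)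

/-- The transpose of the curvature part of the bar differential. -/
def barH (R : CurvedDGA k Γ) : (List R.A → X) → List (Γ × R.A) → X
  | ψ, [] => ψ [R.hEl]
  | ψ, x :: w =>
      gsign k (x.1 - 1) • barH R (fun u => ψ (x.2 :: u)) w +
        ψ (R.hEl :: x.2 :: w.map Prod.snd)

lemma barMul_sub (ψ φ : List R.A → X) (w : List (Γ × R.A)) :
    barMul R (fun u => ψ u - φ u) w = barMul R ψ w - barMul R φ w := by
  induction w generalizing ψ φ with
  | nil => simp [barMul]
  | cons x w ih => simp only [barMul, ih, barMulHead_sub]; module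

lemma barD_sub (ψ φ : List R.A → X) (w : List (Γ × R.A)) :
    barD R (fun u => ψ u - φ u) w = barD R ψ w - barD R φ w := by
  induction w generalizing ψ φ with
  | nil => simp [barD]
  | cons x w ih => simp only [barD, ih]; module

lemma barH_sub (ψ φ : List R.A → X) (w : List (Γ × R.A)) :
    barH R (fun u => ψ u - φ u) w = barH R ψ w - barH R φ w := by
  induction w generalizing ψ φ with
  | nil => simp [barH]
  | cons x w ih => simp only [barH, ih]; module

lemma barMul_zero (w : List (Γ × R.A)) : barMul R (fun _ => (0 : X)) w = 0 := by
  simpa using barMul_sub (fun _ => (0 : X)) (fun _ => 0) w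

lemma barD_zero (w : List (Γ × R.A)) : barD R (fun _ => (0 : X)) w = 0 := by
  simpa using barD_sub (fun _ => (0 : X)) (fun _ => 0) w

lemma barH_zero (w : List (Γ × R.A)) : barH R (fun _ => (0 : X)) w = 0 := by
  simpa using barH_sub (fun _ => (0 : X)) (fun _ => 0) w

/-- A functional on words is multilinear if it is linear in every letter. -/
structure IsMultilinear {A : Type} [AddCommGroup A] [Module k A] (ψ : List A → X) : Prop where
  add : ∀ (u : List A) (x y : A) (w : List A),
    ψ (u ++ (x + y) :: w) = ψ (u ++ x :: w) + ψ (u ++ y :: w)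
  smul : ∀ (u : List A) (c : k) (x : A) (w : List A),
    ψ (u ++ (c • x) :: w) = c • ψ (u ++ x :: w)

lemma IsMultilinear.cons {A : Type} [AddCommGroup A] [Module k A] {ψ : List A → X}
    (hψ : IsMultilinear (k := k) ψ) (z : A) : IsMultilinear (k := k) (fun u => ψ (z :: u)) :=
  ⟨fun u => hψ.add (z :: u), fun u => hψ.smul (z :: u)⟩

/-- The insertion sums over words with one letter less than `m` letters. -/
def insSumPred {E : Type} (b : E) : ℕ → (List E → X) → List E → X
  | 0, _, _ => 0
  | m + 1, φ, l => insSum b m φ l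

variable (β : R.A)

lemma insSum_barMul_nil (ψ : List R.A → X) (m : ℕ) :
    insSum ((1 : Γ), β) (m + 2) (barMul R ψ) [] =
      insSum β m (fun w => ψ (β * β :: w)) []
        - insSum ((1 : Γ), β) (m + 1) (barMul R (fun u => ψ (β :: u))) [] := by
  rw [insSum]
  simp only [barMul, sub_self, gsign_zero, one_smul]
  rw [insSum_add, insSum_barMulHead]
  simp only [barMulHead, List.map_nil]
  abel

lemma insSum_barMul_cons (ψ : List R.A → X) (m : ℕ) (x : Γ × R.A) (l : List (Γ × R.A)) :
    insSum ((1 : Γ), β) (m + 2) (barMul R ψ) (x :: l) =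
      gsign k (x.1 - 1) • (insSum ((1 : Γ), β) (m + 1) (barMul R (fun u => ψ (x.2 :: u))) l
        + barMulHead R (headSum β m ψ) x l
        - insSum β m (fun w => ψ (x.2 * β :: w)) (l.map Prod.snd))
      - insSum ((1 : Γ), β) (m + 1) (barMul R (fun u => ψ (β :: u))) (x :: l)
      - insSum β m (fun w => ψ (β * x.2 :: w)) (l.map Prod.snd)
      + insSum β m (fun w => ψ (β * β :: w)) (x.2 :: l.map Prod.snd) := by
  rw [insSum]
  simp only [barMul, sub_self, gsign_zero, one_smul]
  rw [insSum_smul, insSum_add, insSum_add, insSum_barMulHead, insSum_barMulHead]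
  simp only [barMulHead, List.map_cons, headSum]
  module

lemma insSum_barD_nil (ψ : List R.A → X) (m : ℕ) :
    insSum ((1 : Γ), β) (m + 1) (barD R ψ) [] =
      insSum β m (fun w => ψ (R.d β :: w)) []
        - insSum ((1 : Γ), β) m (barD R (fun u => ψ (β :: u))) [] := by
  rw [insSum]
  simp only [barD, sub_self, gsign_zero, one_smul]
  rw [insSum_sub, insSum_map_snd _ m (fun w => ψ (R.d β :: w))]
  simp

lemma insSum_barD_cons (ψ : List R.A → X) (m : ℕ) (x : Γ × R.A) (l : List (Γ × R.A)) :
    insSum ((1 : Γ), β) (m + 1) (barD R ψ) (x :: l) =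
      gsign k (x.1 - 1) • insSum ((1 : Γ), β) m (barD R (fun u => ψ (x.2 :: u))) l
      - insSum β m (fun w => ψ (R.d x.2 :: w)) (l.map Prod.snd)
      - insSum ((1 : Γ), β) m (barD R (fun u => ψ (β :: u))) (x :: l)
      + insSum β m (fun w => ψ (R.d β :: w)) (x.2 :: l.map Prod.snd) := by
  rw [insSum]
  simp only [barD, sub_self, gsign_zero, one_smul]
  rw [insSum_sub, insSum_sub, insSum_smul, insSum_map_snd _ m (fun w => ψ (R.d β :: w)),
    insSum_map_snd _ m (fun w => ψ (R.d x.2 :: w))]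
  simp only [List.map_cons]
  module

lemma insSum_barH_nil (ψ : List R.A → X) (m : ℕ) :
    insSum ((1 : Γ), β) m (barH R ψ) [] =
      insSum β m (fun w => ψ (R.hEl :: w)) []
        - insSumPred ((1 : Γ), β) m (barH R (fun u => ψ (β :: u))) [] := by
  cases m with
  | zero => simp [insSum, insSumPred, barH]
  | succ m =>
    simp only [insSum, insSumPred]
    simp only [barH, sub_self, gsign_zero, one_smul]
    rw [insSum_add, insSum_map_snd _ m (fun w => ψ (R.hEl :: β :: w))]
    simp only [List.map_nil]
    abel

lemma insSum_barH_cons (ψ : List R.A → X) (m : ℕ) (x : Γ × R.A) (l : List (Γ × R.A)) :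
    insSum ((1 : Γ), β) m (barH R ψ) (x :: l) =
      gsign k (x.1 - 1) • insSumPred ((1 : Γ), β) m (barH R (fun u => ψ (x.2 :: u))) l
      - insSumPred ((1 : Γ), β) m (barH R (fun u => ψ (β :: u))) (x :: l)
      + insSum β m (fun w => ψ (R.hEl :: w)) (x.2 :: l.map Prod.snd) := by
  cases m with
  | zero => simp [insSum, insSumPred]
  | succ m =>
    simp only [insSum, insSumPred]
    simp only [barH, sub_self, gsign_zero, one_smul]
    rw [insSum_add, insSum_add, insSum_smul, insSum_map_snd _ m (fun w => ψ (R.hEl :: β :: w)),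
      insSum_map_snd _ m (fun w => ψ (R.hEl :: x.2 :: w))]
    simp only [List.map_cons]
    module

end BarOperators

section Morphism

variable {R' : CurvedDGA k Γ} {X : Type} [AddCommGroup X]
  {ρ : R.A →ₐ[k] R'.A} {β : R'.A}

lemma barMulHead_map (Φ : List R'.A → X) (x : Γ × R.A) (l : List (Γ × R.A)) :
    barMulHead R (fun w => Φ (w.map ρ)) x l =
      barMulHead R' Φ (Prod.map id ρ x) (l.map (Prod.map id ρ)) := by
  cases l <;> simp [barMulHead, Function.comp_def]

lemma map_snd_map (l : List (Γ × R.A)) :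
    (l.map (Prod.map id ρ)).map Prod.snd = (l.map Prod.snd).map ρ := by
  simp [Function.comp_def]

variable [Module k X]

/-- The pair `(ρ, β)` is a morphism of curved differential graded algebras. -/
structure IsCDGAMorphism (R R' : CurvedDGA k Γ) (ρ : R.A →ₐ[k] R'.A) (β : R'.A) : Prop where
  map_deg : ∀ {γ : Γ} {a : R.A}, a ∈ R.deg γ → ρ a ∈ R'.deg γ
  deg_one : β ∈ R'.deg 1
  map_d : ∀ {γ : Γ} {a : R.A}, a ∈ R.deg γ →
    ρ (R.d a) - R'.d (ρ a) = β * ρ a - gsign k γ • (ρ a * β)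
  map_h : ρ R.hEl = R'.hEl + R'.d β + β * β

lemma IsCDGAMorphism.insSum_map_h (h : IsCDGAMorphism R R' ρ β) {ψ : List R'.A → X}
    (hψ : IsMultilinear (k := k) ψ) (m : ℕ) (l : List R'.A) :
    insSum β m (fun w => ψ (ρ R.hEl :: w)) l =
      insSum β m (fun w => ψ (R'.hEl :: w)) l + insSum β m (fun w => ψ (R'.d β :: w)) l
        + insSum β m (fun w => ψ (β * β :: w)) l := by
  have add := hψ.add []
  simp only [List.nil_append] at add
  simp only [h.map_h, add, insSum_add]

lemma IsCDGAMorphism.insSum_map_d (h : IsCDGAMorphism R R' ρ β) {ψ : List R'.A → X}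
    (hψ : IsMultilinear (k := k) ψ) {γ : Γ} {a : R.A} (ha : a ∈ R.deg γ) (m : ℕ)
    (l : List R'.A) :
    insSum β m (fun w => ψ (ρ (R.d a) :: w)) l =
      insSum β m (fun w => ψ (R'.d (ρ a) :: w)) l + insSum β m (fun w => ψ (β * ρ a :: w)) l
        - gsign k γ • insSum β m (fun w => ψ (ρ a * β :: w)) l := by
  have add := hψ.add []
  have smul := hψ.smul []
  simp only [List.nil_append] at add smul
  have e : ρ (R.d a) = R'.d (ρ a) + β * ρ a + (-gsign k γ) • (ρ a * β) := by
    rw [sub_eq_iff_eq_add'.1 (h.map_d ha)]; module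
  simp only [e, add, smul, insSum_add, insSum_smul]
  module

/-- Insertion of `β` intertwines the bar differentials. -/
theorem IsCDGAMorphism.insSum_bar (h : IsCDGAMorphism R R' ρ β) {ψ : List R'.A → X}
    (hψ : IsMultilinear (k := k) ψ) (m : ℕ) (l : List (Γ × R.A))
    (hl : ∀ x ∈ l, x.2 ∈ R.deg x.1) :
    insSum ((1 : Γ), β) (m + 1) (barMul R' ψ) (l.map (Prod.map id ρ))
      + insSum ((1 : Γ), β) m (barD R' ψ) (l.map (Prod.map id ρ))
      + insSumPred ((1 : Γ), β) m (barH R' ψ) (l.map (Prod.map id ρ)) =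
    barMul R (fun w => insSum β m ψ (w.map ρ)) l
      + barD R (fun w => insSum β m ψ (w.map ρ)) l
      + barH R (fun w => insSum β m ψ (w.map ρ)) l := by
  induction m generalizing ψ l with
  | zero =>
    cases l with
    | nil => simp [insSum, insSumPred, barMul, barD, barH, barMulHead]
    | cons x l =>
      have hz : barMulHead R (fun w => insSum β 0 ψ (w.map ρ)) x l = 0 := by
        cases l <;> rfl
      rw [barMul, hz]
      cases l with
      | nil => simp [insSum, insSumPred, barMul, barD, barH, barMulHead]
      | cons y l =>
        simp [insSum, insSumPred, barMul, barD, barH, barMul_zero, barD_zero, barH_zero,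
          barMulHead_zero]
  | succ m ih =>
    simp only [insSum_succ β m ψ, barMul_sub, barD_sub, barH_sub]
    have ihβ := ih (hψ.cons β) l hl
    cases l with
    | nil =>
      have hh := h.insSum_map_h hψ m []
      simp only [List.map_nil] at ihβ ⊢
      rw [insSum_barMul_nil, insSum_barD_nil, insSumPred, insSum_barH_nil]
      simp only [barMul, barD, barH, List.map_cons, List.map_nil, headSum] at ihβ ⊢
      linear_combination (norm := module) -ihβ - hh
    | cons x l =>
      simp only [List.mem_cons, forall_eq_or_imp] at hl
      have ihx := ih (hψ.cons (ρ x.2)) l hl.2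
      have hh := h.insSum_map_h hψ m (ρ x.2 :: (l.map Prod.snd).map ρ)
      have hd := h.insSum_map_d hψ hl.1 m ((l.map Prod.snd).map ρ)
      have hM := barMulHead_map (headSum β m ψ) x l (ρ := ρ)
      simp only [List.map_cons] at ihβ ⊢
      rw [insSum_barMul_cons, insSum_barD_cons, insSumPred, insSum_barH_cons, map_snd_map]
      rw [barMul, barD, barH, hM]
      simp only [List.map_cons, headSum, Prod.map_fst, Prod.map_snd, id_eq,
        gsign_sub_one] at ihβ ihx hh hd ⊢
      linear_combination (norm := module) (-gsign k x.1) • ihx - ihβ - hh + hd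

end Morphism

section ChainOperators

variable {R' : CurvedDGA k Γ} {X : Type} [AddCommGroup X] [Module k X]

/-- The total shifted degree of a word of labelled letters. -/
def shiftedDeg {A : Type} (w : List (Γ × A)) : Γ := (w.map fun x => x.1 - 1).sum

lemma shiftedDeg_map {A A' : Type} (f : A → A') (w : List (Γ × A)) :
    shiftedDeg (w.map (Prod.map id f)) = shiftedDeg w := by
  simp [shiftedDeg, Function.comp_def]

lemma insSum_smul_shiftedDeg {A : Type} (β : A) (m : ℕ) (c : Γ → k) (φ : List (Γ × A) → X)
    (l : List (Γ × A)) :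
    insSum ((1 : Γ), β) m (fun w => c (shiftedDeg w) • φ w) l =
      c (shiftedDeg l) • insSum ((1 : Γ), β) m φ l := by
  rw [← insSum_smul]
  refine insSum_congr _ (fun _ => True) trivial (fun x => x.1 - 1) (sub_self _) m _ _ l
    (fun _ _ => trivial) fun w _ _ hs => ?_
  rw [shiftedDeg, hs, shiftedDeg]

/-- The transpose of the cyclic term of the Hochschild differential. -/
def barCyc (R : CurvedDGA k Γ) (ψ : List R.A → X) (x : Γ × R.A) (w : List (Γ × R.A)) : X :=
  match w.getLast? with
  | none => 0
  | some y => gsign2 k (y.1 - 1) (x.1 + shiftedDeg w.dropLast) •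
      ψ (y.2 * x.2 :: w.dropLast.map Prod.snd)

lemma barCyc_nil (ψ : List R.A → X) (x : Γ × R.A) : barCyc R ψ x [] = 0 := rfl

lemma barCyc_append (ψ : List R.A → X) (x y : Γ × R.A) (w : List (Γ × R.A)) :
    barCyc R ψ x (w ++ [y]) = gsign2 k (y.1 - 1) (x.1 + shiftedDeg w) •
      ψ (y.2 * x.2 :: w.map Prod.snd) := by
  simp [barCyc]

lemma insSum_barCyc (ψ : List R.A → X) (β : R.A) (m : ℕ) (x : Γ × R.A)
    (l : List (Γ × R.A)) :
    insSum ((1 : Γ), β) (m + 1) (barCyc R ψ x) l =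
      barCyc R (headSum β m ψ) x l -
        insSum β m (fun w => ψ (β * x.2 :: w)) (l.map Prod.snd) := by
  rcases List.eq_nil_or_concat' l with rfl | ⟨l, y, rfl⟩
  · rw [insSum_nil_right]
    simp only [barCyc_append, sub_self, gsign2_zero_left, one_smul, barCyc_nil]
    rw [insSum_map_snd ((1 : Γ), β) m (fun w => ψ (β * x.2 :: w))]
    simp
  · rw [insSum_append_right]
    simp only [barCyc_append, sub_self, gsign2_zero_left, one_smul]
    rw [insSum_map_snd ((1 : Γ), β) m (fun w => ψ (β * x.2 :: w)),
      insSum_smul_shiftedDeg β m (fun s => gsign2 k (y.1 - 1) (x.1 + s)),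
      insSum_map_snd ((1 : Γ), β) m (fun w => ψ (y.2 * x.2 :: w))]
    rfl

lemma barCyc_map {ρ : R.A →ₐ[k] R'.A} (Φ : List R'.A → X) (x : Γ × R.A)
    (l : List (Γ × R.A)) :
    barCyc R (fun w => Φ (w.map ρ)) x l =
      barCyc R' Φ (Prod.map id ρ x) (l.map (Prod.map id ρ)) := by
  rcases List.eq_nil_or_concat' l with rfl | ⟨l, y, rfl⟩
  · rfl
  · rw [List.map_append, List.map_singleton, barCyc_append, barCyc_append, shiftedDeg_map,
      map_snd_map]
    simp

/-- The transpose of the multiplicative part of the Hochschild differential. -/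
def hochMul (R : CurvedDGA k Γ) (ψ : List R.A → X) (x : Γ × R.A) (w : List (Γ × R.A)) : X :=
  -barMul R ψ (x :: w) - barCyc R ψ x w

/-- The transpose of the part of the Hochschild differential given by `d`. -/
def hochD (R : CurvedDGA k Γ) (ψ : List R.A → X) (x : Γ × R.A) (w : List (Γ × R.A)) : X :=
  -barD R ψ (x :: w)

/-- The transpose of the curvature part of the Hochschild differential. -/
def hochH (R : CurvedDGA k Γ) (ψ : List R.A → X) (x : Γ × R.A) (w : List (Γ × R.A)) : X :=
  -(gsign k (x.1 - 1) • barH R (fun u => ψ (x.2 :: u)) w)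

/-- The transpose of the Connes operator. -/
def connesSum (R : CurvedDGA k Γ) (ψ : List R.A → X) (x : Γ × R.A) : List (Γ × R.A) → X :=
  splitSum fun u v => gsign2 k (shiftedDeg v) (x.1 - 1 + shiftedDeg u) •
    ψ (1 :: (v.map Prod.snd ++ x.2 :: u.map Prod.snd))

variable {ρ : R.A →ₐ[k] R'.A} {β : R'.A}

lemma insSumPred_neg {E : Type} (b : E) (m : ℕ) (φ : List E → X) (l : List E) :
    insSumPred b m (fun w => -φ w) l = -insSumPred b m φ l := by
  cases m <;> simp [insSumPred, insSum_neg]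

lemma insSumPred_smul {E : Type} (b : E) (m : ℕ) (c : k) (φ : List E → X) (l : List E) :
    insSumPred b m (fun w => c • φ w) l = c • insSumPred b m φ l := by
  cases m <;> simp [insSumPred, insSum_smul]

/-- Insertion of `β` intertwines the Hochschild differentials. -/
theorem IsCDGAMorphism.insSum_hoch (h : IsCDGAMorphism R R' ρ β) {ψ : List R'.A → X}
    (hψ : IsMultilinear (k := k) ψ) (m : ℕ) (x : Γ × R.A) (l : List (Γ × R.A))
    (hl : ∀ y ∈ x :: l, y.2 ∈ R.deg y.1) :
    insSum ((1 : Γ), β) (m + 1) (hochMul R' ψ (Prod.map id ρ x)) (l.map (Prod.map id ρ))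
      + insSum ((1 : Γ), β) m (hochD R' ψ (Prod.map id ρ x)) (l.map (Prod.map id ρ))
      + insSumPred ((1 : Γ), β) m (hochH R' ψ (Prod.map id ρ x)) (l.map (Prod.map id ρ)) =
    hochMul R (fun w => headSum β m ψ (w.map ρ)) x l
      + hochD R (fun w => headSum β m ψ (w.map ρ)) x l
      + hochH R (fun w => headSum β m ψ (w.map ρ)) x l := by
  simp only [List.mem_cons, forall_eq_or_imp] at hl
  have ihx := h.insSum_bar (hψ.cons (ρ x.2)) m l hl.2
  have hd := h.insSum_map_d hψ hl.1 m ((l.map Prod.snd).map ρ)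
  have hM := barMulHead_map (headSum β m ψ) x l (ρ := ρ)
  have hC := barCyc_map (headSum β m ψ) x l (ρ := ρ)
  unfold hochMul hochD hochH
  rw [hC, barMul, barD, hM]
  simp only [barMul, barD]
  rw [insSumPred_neg, insSumPred_smul, insSum_neg, insSum_sub, insSum_sub, insSum_neg,
    insSum_smul, insSum_smul, insSum_add, insSum_barMulHead, insSum_barCyc,
    insSum_map_snd _ m (fun w => ψ (R'.d (Prod.map id ρ x).2 :: w)), map_snd_map]
  simp only [List.map_cons, headSum, Prod.map_fst, Prod.map_snd, id_eq,
    gsign_sub_one] at ihx hd ⊢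
  linear_combination (norm := module) gsign k x.1 • ihx - hd

/-- Insertion of `β` intertwines the Connes operators. -/
theorem insSum_connesSum (ψ : List R'.A → X) (m : ℕ) (x : Γ × R.A) (l : List (Γ × R.A)) :
    insSum ((1 : Γ), β) m (connesSum R' ψ (Prod.map id ρ x)) (l.map (Prod.map id ρ)) =
      connesSum R (fun w => headSum β (m + 1) ψ (w.map ρ)) x l := by
  unfold connesSum
  rw [insSum_splitSum, splitSum_map]
  refine splitSum_congr _ _ _ fun u v _ => ?_
  simp only [List.map_cons, List.map_append, map_one, headSum]
  rw [insSum_append_cons β m (fun w => ψ (1 :: w)), insSum₂_swap β m]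
  unfold insSum₂
  rw [Finset.smul_sum]
  refine Finset.sum_congr rfl fun p _ => ?_
  have key (u' : List (Γ × R'.A)) := insSum_smul_shiftedDeg β p.2
    (fun s => gsign2 k s (x.1 - 1 + shiftedDeg u'))
    (fun v' => ψ (1 :: (v'.map Prod.snd ++ ρ x.2 :: u'.map Prod.snd))) (v.map (Prod.map id ρ))
  simp only [Prod.map_fst, Prod.map_snd, id_eq, key]
  rw [insSum_smul_shiftedDeg β p.1
    (fun s => gsign2 k (shiftedDeg (v.map (Prod.map id ρ))) (x.1 - 1 + s)), shiftedDeg_map,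
    shiftedDeg_map]
  have key' (u' : List R'.A) := insSum_map_snd ((1 : Γ), β) p.2
    (fun v' => ψ (1 :: (v' ++ ρ x.2 :: u'))) (v.map (Prod.map id ρ))
  simp only [key']
  rw [insSum_map_snd ((1 : Γ), β) p.1 (fun u' => insSum β p.2
    (fun v' => ψ (1 :: (v' ++ ρ x.2 :: u'))) ((v.map (Prod.map id ρ)).map Prod.snd)),
    map_snd_map, map_snd_map]

end ChainOperators

section Words

/-- The sequence of the letters of a word, extended by zero. -/
def toFn {α : Type} [Zero α] (l : List α) : ℕ → α := fun i => l.getD i 0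

lemma toFn_cons_zero {α : Type} [Zero α] (x : α) (l : List α) : toFn (x :: l) 0 = x := rfl

lemma toFn_cons_succ {α : Type} [Zero α] (x : α) (l : List α) (i : ℕ) :
    toFn (x :: l) (i + 1) = toFn l i := rfl

lemma toFn_cons_of_pos {α : Type} [Zero α] (x : α) (l : List α) (i : ℕ) (hi : 0 < i) :
    toFn (x :: l) i = toFn l (i - 1) := by
  cases i with
  | zero => omega
  | succ i => rfl

lemma toFn_append_cons {α : Type} [Zero α] (u w : List α) (z : α) :
    toFn (u ++ z :: w) = Function.update (toFn (u ++ 0 :: w)) u.length z := by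
  funext i
  simp only [toFn, Function.update_apply, List.getD_eq_getElem?_getD]
  grind

lemma toFn_drop {α : Type} [Zero α] (l : List α) (j i : ℕ) :
    toFn (l.drop j) i = toFn l (j + i) := by
  simp [toFn, List.getD_eq_getElem?_getD]

lemma toFn_take_append_cons {α : Type} [Zero α] (l l' : List α) (z : α) (i j : ℕ)
    (hj : j ≤ l.length) :
    toFn (l.take j ++ z :: l') i =
      if i < j then toFn l i else if i = j then z else toFn l' (i - (j + 1)) := by
  simp only [toFn, List.getD_eq_getElem?_getD, List.getElem?_append, List.length_take,
    min_eq_left hj]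
  grind

lemma homog_toFn (n : ℕ) (L : List (Γ × R.A)) (hL : ∀ y ∈ L, y.2 ∈ R.deg y.1)
    (hn : L.length = n + 1) :
    R.Homog n (toFn (L.map Prod.fst)) (toFn (L.map Prod.snd)) := by
  intro i hi
  have h : i < L.length := by omega
  simpa [toFn, List.getD_eq_getElem?_getD, h] using hL _ (List.getElem_mem h)

lemma shiftedDeg_take {A : Type} (L : List (Γ × A)) (j : ℕ) (hj : j ≤ L.length) :
    shiftedDeg (L.take j) = degSum (toFn (L.map Prod.fst)) j - (j : Γ) := by
  induction L generalizing j with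
  | nil =>
    obtain rfl : j = 0 := by simpa using hj
    simp [shiftedDeg, degSum]
  | cons x L ih =>
    cases j with
    | zero => simp [shiftedDeg, degSum]
    | succ j =>
      have := ih j (by simpa using hj)
      simp only [shiftedDeg, degSum] at this ⊢
      rw [List.take_succ_cons, List.map_cons, List.sum_cons, this, Finset.sum_range_succ']
      simp only [List.map_cons, toFn_cons_succ, toFn_cons_zero, Nat.cast_add, Nat.cast_one]
      abel

lemma shiftedDeg_drop {A : Type} (L : List (Γ × A)) (j : ℕ) (hj : j ≤ L.length) :
    shiftedDeg (L.drop j) =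
      ∑ t ∈ Finset.Ico j L.length, toFn (L.map Prod.fst) t - ((L.length - j : ℕ) : Γ) := by
  have h : shiftedDeg (L.take j) + shiftedDeg (L.drop j) = shiftedDeg (L.take L.length) := by
    rw [List.take_length, shiftedDeg, shiftedDeg, ← List.sum_append, ← List.map_append,
      List.take_append_drop, shiftedDeg]
  rw [← eq_sub_iff_add_eq'] at h
  rw [h, shiftedDeg_take _ _ hj, shiftedDeg_take _ _ le_rfl, Finset.sum_Ico_eq_sub _ hj,
    Nat.cast_sub hj, degSum, degSum]
  abel

lemma gsign_degSum_succ {A : Type} (L : List (Γ × A)) (j : ℕ) (hj : j + 1 ≤ L.length) :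
    gsign k (degSum (toFn (L.map Prod.fst)) (j + 1) - (j : Γ)) =
      -gsign k (shiftedDeg (L.take (j + 1))) := by
  rw [shiftedDeg_take L _ hj, Nat.cast_add, Nat.cast_one, ← sub_sub, gsign_sub_one, neg_neg]

lemma shiftedDeg_cons {A : Type} (x : Γ × A) (w : List (Γ × A)) :
    shiftedDeg (x :: w) = x.1 - 1 + shiftedDeg w := rfl

variable {X : Type} [AddCommGroup X] [Module k X]

lemma barMul_eq_sum (ψ : List R.A → X) (x : Γ × R.A) (w : List (Γ × R.A)) :
    barMul R ψ (x :: w) = ∑ j ∈ range w.length, gsign k (shiftedDeg ((x :: w).take (j + 1))) •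
      ψ (((x :: w).map Prod.snd).take j ++
        (toFn ((x :: w).map Prod.snd) j * toFn ((x :: w).map Prod.snd) (j + 1)) ::
          ((x :: w).map Prod.snd).drop (j + 2)) := by
  induction w generalizing x ψ with
  | nil => simp [barMul, barMulHead]
  | cons y w ih =>
    rw [barMul, ih, List.length_cons, Finset.sum_range_succ', smul_add, Finset.smul_sum]
    congr 1
    · refine Finset.sum_congr rfl fun j _ => ?_
      rw [List.take_succ_cons (i := j + 1), shiftedDeg_cons, gsign_add, mul_smul]
      rfl
    · simp [shiftedDeg, barMulHead, toFn]

lemma barD_eq_sum (ψ : List R.A → X) (w : List (Γ × R.A)) :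
    barD R ψ w = -∑ j ∈ range w.length, gsign k (shiftedDeg (w.take j)) •
      ψ ((w.map Prod.snd).set j (R.d (toFn (w.map Prod.snd) j))) := by
  induction w generalizing ψ with
  | nil => simp [barD]
  | cons x w ih =>
    rw [barD, ih, List.length_cons, Finset.sum_range_succ', neg_add, ← sub_eq_add_neg, smul_neg,
      Finset.smul_sum]
    congr 1
    · congr 1
      refine Finset.sum_congr rfl fun j _ => ?_
      rw [List.take_succ_cons, shiftedDeg_cons, gsign_add, mul_smul]
      rfl
    · simp [shiftedDeg, toFn, gsign_zero]

lemma barH_eq_sum (ψ : List R.A → X) (w : List (Γ × R.A)) :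
    barH R ψ w = ∑ j ∈ range (w.length + 1), gsign k (shiftedDeg (w.take j)) •
      ψ ((w.map Prod.snd).take j ++ R.hEl :: (w.map Prod.snd).drop j) := by
  induction w generalizing ψ with
  | nil => simp [barH, shiftedDeg, gsign_zero]
  | cons x w ih =>
    rw [barH, ih, List.length_cons, Finset.sum_range_succ' _ (w.length + 1), Finset.smul_sum]
    congr 1
    · refine Finset.sum_congr rfl fun j _ => ?_
      rw [List.take_succ_cons, shiftedDeg_cons, gsign_add, mul_smul]
      rfl
    · simp [shiftedDeg, gsign_zero]

end Words

section Models

variable (H : RedAlgHochParts k Γ R)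

/-- The chain given by a word with `m + 1` letters. -/
def word (m : ℕ) (l : List R.A) : H.W m :=
  if l.length = m + 1 then H.gen m (toFn l) else 0

lemma word_eq {m : ℕ} {l : List R.A} (hl : l.length = m + 1) {a : ℕ → R.A}
    (ha : ∀ i ≤ m, toFn l i = a i) : H.word m l = H.gen m a := by
  rw [word, if_pos hl]
  exact H.gen_ext ha

lemma isMultilinear_word (m : ℕ) : IsMultilinear (k := k) (H.word m) := by
  constructor
  · intro u x y w
    simp only [word, List.length_append, List.length_cons]
    split_ifs with h
    · rw [toFn_append_cons, H.gen_add _ _ _ (by omega), ← toFn_append_cons, ← toFn_append_cons]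
    · simp
  · intro u c x w
    simp only [word, List.length_append, List.length_cons]
    split_ifs with h
    · rw [toFn_append_cons, H.gen_smul _ _ _ (by omega), ← toFn_append_cons]
    · simp

lemma b2_word (n : ℕ) (x : Γ × R.A) (w : List (Γ × R.A)) (hw : w.length = n + 1)
    (hL : ∀ y ∈ x :: w, y.2 ∈ R.deg y.1) :
    H.b2 n (H.word (n + 1) ((x :: w).map Prod.snd)) = hochMul R (H.word n) x w := by
  rw [H.word_eq (by simp [hw]) (fun _ _ => rfl),
    H.b2_gen n _ _ (homog_toFn (n + 1) (x :: w) hL (by simp [hw])), hochMul, barMul_eq_sum, hw,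
    ← Finset.sum_neg_distrib]
  congr 1
  · refine Finset.sum_congr rfl fun j hj => ?_
    rw [Finset.mem_range] at hj
    rw [gsign_degSum_succ _ _ (by simp; omega), neg_smul]
    congr 2
    refine (H.word_eq (by simp; omega) fun i hi => ?_).symm
    rw [toFn_take_append_cons _ _ _ _ _ (by simp; omega), toFn_drop, contractChain]
    grind
  · rcases List.eq_nil_or_concat' w with rfl | ⟨w, y, rfl⟩
    · simp at hw
    · have hw' : w.length = n := by simpa using hw
      subst hw'
      rw [barCyc_append]
      congr 1
      · congr 1
        · simp [toFn]
        · have := shiftedDeg_take (x :: (w ++ [y])) (w.length + 1) (by simp)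
          rw [sub_eq_iff_eq_add.1 this.symm]
          simp [shiftedDeg_cons]
          abel
      · refine (H.word_eq (by simp) fun i hi => ?_).symm
        simp only [toFn, List.getD_eq_getElem?_getD]
        grind

lemma b1_word (n : ℕ) (x : Γ × R.A) (w : List (Γ × R.A)) (hw : w.length = n)
    (hL : ∀ y ∈ x :: w, y.2 ∈ R.deg y.1) :
    H.b1 n (H.word n ((x :: w).map Prod.snd)) = hochD R (H.word n) x w := by
  rw [H.word_eq (by simp [hw]) (fun _ _ => rfl),
    H.b1_gen n _ _ (homog_toFn n (x :: w) hL (by simp [hw])), hochD, barD_eq_sum, neg_neg,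
    List.length_cons, hw]
  refine Finset.sum_congr rfl fun j hj => ?_
  rw [Finset.mem_range] at hj
  rw [shiftedDeg_take _ _ (by simp; omega)]
  congr 1
  refine (H.word_eq (by simp; omega) fun i hi => ?_).symm
  simp only [toFn, Function.update_apply, List.getD_eq_getElem?_getD]
  grind

lemma b0_word (n : ℕ) (x : Γ × R.A) (w : List (Γ × R.A)) (hw : w.length = n)
    (hL : ∀ y ∈ x :: w, y.2 ∈ R.deg y.1) :
    H.b0 n (H.word n ((x :: w).map Prod.snd)) = hochH R (H.word (n + 1)) x w := by
  rw [H.word_eq (by simp [hw]) (fun _ _ => rfl),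
    H.b0_gen n _ _ (homog_toFn n (x :: w) hL (by simp [hw])), hochH, barH_eq_sum, hw,
    Finset.smul_sum, ← Finset.sum_neg_distrib]
  refine Finset.sum_congr rfl fun j hj => ?_
  rw [Finset.mem_range] at hj
  rw [gsign_degSum_succ _ _ (by simp; omega), neg_smul, List.take_succ_cons, shiftedDeg_cons,
    gsign_add, mul_smul]
  congr 3
  refine (H.word_eq (by simp; omega) fun i hi => ?_).symm
  rw [← List.cons_append, ← List.take_succ_cons, toFn_take_append_cons _ _ _ _ _ (by simp; omega),
    toFn_drop, insertChain]
  cases i with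
  | zero => simp [toFn]
  | succ i => simp only [toFn_cons_succ, List.map_cons]; grind [toFn_cons_of_pos]

lemma Bop_word (n : ℕ) (x : Γ × R.A) (w : List (Γ × R.A)) (hw : w.length = n)
    (hL : ∀ y ∈ x :: w, y.2 ∈ R.deg y.1) :
    H.Bop n (H.word n ((x :: w).map Prod.snd)) = connesSum R (H.word (n + 1)) x w := by
  subst hw
  rw [H.word_eq (by simp) (fun _ _ => rfl),
    H.Bop_gen _ _ _ (homog_toFn _ (x :: w) hL (by simp)), connesSum, splitSum_eq_sum,
    Finset.sum_range_succ', Finset.sum_range_succ]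
  congr 1
  · refine Finset.sum_congr rfl fun j hj => ?_
    rw [Finset.mem_range] at hj
    have h₁ := shiftedDeg_take (x :: w) (j + 1) (by simp; omega)
    have h₂ := shiftedDeg_drop (x :: w) (j + 1) (by simp; omega)
    rw [List.take_succ_cons, shiftedDeg_cons] at h₁
    rw [List.drop_succ_cons, List.length_cons] at h₂
    rw [h₁, h₂, show w.length - (j + 1) + 1 = w.length + 1 - (j + 1) by omega]
    congr 1
    refine (H.word_eq (by simp; omega) fun i hi => ?_).symm
    cases i with
    | zero => simp [toFn]
    | succ i =>
      rw [if_neg (by omega), toFn_cons_succ]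
      simp only [toFn, List.getD_eq_getElem?_getD, List.getElem?_append, List.getElem?_map,
        List.length_map, List.length_drop, List.getElem?_drop]
      by_cases h : i < w.length - j
      · rw [if_pos h, Nat.mod_eq_of_lt (by omega), show j + 1 + (i + 1) - 1 = j + i + 1 by omega,
          List.getElem?_cons_succ]
      · rw [if_neg h, Nat.mod_eq_sub_mod (by omega), Nat.mod_eq_of_lt (by omega),
          show j + 1 + (i + 1) - 1 - (w.length + 1) = i - (w.length - j) by omega]
        generalize hp : i - (w.length - j) = p
        cases p with
        | zero => simp
        | succ p => simp [show p < j by omega]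
  · simp only [degSum, Finset.sum_range_zero, Nat.cast_zero, sub_self, gsign2_zero_right,
      List.drop_length, shiftedDeg, List.map_nil, List.sum_nil, gsign2_zero_left, List.nil_append,
      List.take_length]
    congr 1
    refine (H.word_eq (by simp) fun i hi => ?_).symm
    cases i with
    | zero => rfl
    | succ i =>
      rw [if_neg (by omega), Nat.mod_eq_of_lt (by omega), zero_add, Nat.add_sub_cancel]
      rfl

/-- Linear maps agreeing on the chains with homogeneous letters are equal. -/
lemma hom_ext_word {X : Type} [AddCommGroup X] [Module k X] {n : ℕ} {f f' : H.W n →ₗ[k] X}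
    (h : ∀ (x : Γ × R.A) (w : List (Γ × R.A)), w.length = n →
      (∀ y ∈ x :: w, y.2 ∈ R.deg y.1) →
      f (H.word n ((x :: w).map Prod.snd)) = f' (H.word n ((x :: w).map Prod.snd))) :
    f = f' := by
  refine LinearMap.ext_on (H.span_gen n) ?_
  rintro _ ⟨a, g, hag, rfl⟩
  have hL : ∀ y ∈ (g 0, a 0) :: (List.range n).map (fun i => (g (i + 1), a (i + 1))),
      y.2 ∈ R.deg y.1 := by
    simp only [List.mem_cons, List.mem_map, List.mem_range, forall_eq_or_imp,
      forall_exists_index, and_imp]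
    refine ⟨hag 0 (by omega), ?_⟩
    rintro _ i hi rfl
    exact hag (i + 1) (by omega)
  have := h _ _ (by simp) hL
  rwa [H.word_eq (a := a) (by simp)] at this
  intro i hi
  cases i with
  | zero => rfl
  | succ i => simp [toFn, show i < n by omega]

end Models

section Interleave

variable {A : Type}

lemma interleave_of_eq (b : A) (f : ℕ → A) (v : ℕ → ℕ) {n t p : ℕ} (ht : t ≤ n)
    (hp : t + ∑ s ∈ Finset.range t, v s = p) : interleave b f v n p = f t := by
  have hmono : StrictMono fun t => t + ∑ s ∈ Finset.range t, v s :=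
    strictMono_nat_of_lt_succ fun t => by
      simp only [Finset.sum_range_succ]
      omega
  have h : ∃ t, t ≤ n ∧ t + ∑ s ∈ Finset.range t, v s = p := ⟨t, ht, hp⟩
  rw [interleave, dif_pos h]
  congr 1
  exact hmono.injective (h.choose_spec.2.trans hp.symm)

lemma interleave_succ (b : A) (f : ℕ → A) (v : ℕ → ℕ) (n p : ℕ) :
    interleave b f v (n + 1) (v 0 + (p + 1)) =
      interleave b (fun i => f (i + 1)) (fun i => v (i + 1)) n p := by
  by_cases h : ∃ t, t ≤ n ∧ t + ∑ s ∈ Finset.range t, v (s + 1) = p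
  · obtain ⟨t, ht, hp⟩ := h
    rw [interleave_of_eq b _ _ ht hp]
    refine interleave_of_eq b f v (by omega) ?_
    rw [Finset.sum_range_succ']
    omega
  · rw [interleave, interleave, dif_neg h, dif_neg]
    rintro ⟨t, ht, hp⟩
    cases t with
    | zero => simp at hp
    | succ t =>
      rw [Finset.sum_range_succ'] at hp
      exact h ⟨t, by omega, by omega⟩

lemma interleave_of_le (b : A) (f : ℕ → A) (v : ℕ → ℕ) (n p : ℕ) (hp : p + 1 ≤ v 0) :
    interleave b f v n (p + 1) = b := by
  rw [interleave, dif_neg]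
  rintro ⟨t, ht, h⟩
  cases t with
  | zero => simp at h
  | succ t =>
    rw [Finset.sum_range_succ'] at h
    omega

lemma length_blockWord (b : A) (v : ℕ → ℕ) (l : List A) :
    (blockWord b v l).length = l.length + ∑ s ∈ Finset.range (l.length + 1), v s := by
  induction l generalizing v with
  | nil => simp [blockWord]
  | cons x l ih =>
    simp only [blockWord, List.length_append, List.length_replicate, List.length_cons, ih]
    rw [Finset.sum_range_succ' _ (l.length + 1)]
    omega

lemma toFn_blockWord [Zero A] (b : A) (v : ℕ → ℕ) (x : A) (l : List A) (p : ℕ)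
    (hp : p < (x :: blockWord b v l).length) :
    toFn (x :: blockWord b v l) p = interleave b (toFn (x :: l)) v l.length p := by
  induction l generalizing x v p with
  | nil =>
    cases p with
    | zero => exact (interleave_of_eq (t := 0) b (toFn [x]) v (Nat.zero_le _) (by simp)).symm
    | succ p =>
      simp only [blockWord, List.length_cons, List.length_replicate] at hp
      rw [interleave_of_le b _ v _ _ (by omega), toFn_cons_succ]
      simp [toFn, blockWord, show p < v 0 by omega]
  | cons y l ih =>
    cases p with
    | zero =>
      exact (interleave_of_eq (t := 0) b (toFn (x :: y :: l)) v (Nat.zero_le _) (by simp)).symm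
    | succ p =>
      rw [toFn_cons_succ]
      by_cases h : p < v 0
      · rw [interleave_of_le b _ v _ _ (by omega)]
        simp [toFn, blockWord, List.getElem?_append, h]
      · obtain ⟨q, rfl⟩ := Nat.exists_eq_add_of_le (not_lt.1 h)
        rw [List.length_cons, add_assoc, interleave_succ]
        have hq : q < (y :: blockWord b (fun i => v (i + 1)) l).length := by
          simp only [blockWord, List.length_append, List.length_cons,
            List.length_replicate] at hp ⊢
          omega
        refine Eq.trans ?_ (ih _ y q hq)
        simp [toFn, blockWord, List.getElem?_append]

end Interleave

section InducedMap

variable {R' : CurvedDGA k Γ} (H : RedAlgHochParts k Γ R) (H' : RedAlgHochParts k Γ R')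
  {ρ : R.A →ₐ[k] R'.A} {β : R'.A}

/-- The weight components of the map induced by `(ρ, β)`. -/
structure IsInduced (ρ : R.A →ₐ[k] R'.A) (β : R'.A)
    (F : (n m : ℕ) → H.W n →ₗ[k] H'.W m) : Prop where
  zero : ∀ {n m : ℕ}, m < n → F n m = 0
  gen : ∀ (n m : ℕ), n ≤ m → ∀ (a : ℕ → R.A) (g : ℕ → Γ), R.Homog n g a →
    F n m (H.gen n a) = ((-1 : k) ^ (m - n)) •
      ∑ v ∈ Finset.Nat.antidiagonalTuple (n + 1) (m - n),
        H'.gen m (interleave β (fun i => ρ (a i)) (extTuple v) n)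

variable {H H'} {F : (n m : ℕ) → H.W n →ₗ[k] H'.W m}

lemma IsInduced.apply_word (hF : IsInduced H H' ρ β F) (n m : ℕ) (x : Γ × R.A)
    (w : List (Γ × R.A)) (hw : w.length = n) (hL : ∀ y ∈ x :: w, y.2 ∈ R.deg y.1) :
    F n m (H.word n ((x :: w).map Prod.snd)) =
      headSum β m (H'.word m) (((x :: w).map Prod.snd).map ρ) := by
  rw [List.map_cons, List.map_cons, headSum]
  have hl : ((w.map Prod.snd).map ρ).length = n := by simp [hw]
  rcases lt_or_ge m n with h | h
  · rw [hF.zero h, insSum_of_lt _ _ _ _ (by omega), LinearMap.zero_apply]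
  · obtain ⟨N, rfl⟩ := Nat.exists_eq_add_of_le h
    have key := insSum_eq_sum_blockWord (k := k) β
      (fun u => H'.word (n + N) (ρ x.2 :: u)) ((w.map Prod.snd).map ρ) N
    rw [hl] at key
    rw [key, ← List.map_cons (f := Prod.snd), H.word_eq (by simp [hw]) (fun _ _ => rfl),
      hF.gen n _ h _ _ (homog_toFn n (x :: w) hL (by simp [hw])), Nat.add_sub_cancel_left]
    congr 1
    refine Finset.sum_congr rfl fun v hv => ?_
    rw [Finset.Nat.mem_antidiagonalTuple] at hv
    have hlen : (ρ x.2 :: blockWord β (extTuple v) ((w.map Prod.snd).map ρ)).length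
        = n + N + 1 := by
      have hsum : ∑ s : Fin (n + 1), extTuple v s = N := by
        rw [← hv]
        exact Finset.sum_congr rfl fun s _ => dif_pos s.2
      rw [List.length_cons, length_blockWord, hl, Finset.sum_range, hsum]
    refine (H'.word_eq hlen fun i hi => ?_).symm
    rw [toFn_blockWord _ _ _ _ _ (by omega), hl]
    congr 1
    funext j
    simp only [toFn, List.getD_eq_getElem?_getD, ← List.map_cons, List.getElem?_map]
    cases (x :: w)[j]? <;> simp

end InducedMap

section Naturality

variable {X Y : Type} [AddCommGroup X] [Module k X] [AddCommGroup Y] [Module k Y]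

lemma barMulHead_comp (f : X →ₗ[k] Y) (ψ : List R.A → X) (φ : List R.A → Y) (x : Γ × R.A)
    (w : List (Γ × R.A)) (hx : x.2 ∈ R.deg x.1) (hw : ∀ y ∈ w, y.2 ∈ R.deg y.1)
    (h : ∀ u : List R.A, u.length = w.length → (∀ a ∈ u, ∃ γ, a ∈ R.deg γ) → f (ψ u) = φ u) :
    f (barMulHead R ψ x w) = barMulHead R φ x w := by
  cases w with
  | nil => exact map_zero f
  | cons y w =>
    simp only [List.mem_cons, forall_eq_or_imp] at hw
    refine h _ (by simp) ?_
    simp only [List.mem_cons, List.mem_map, forall_eq_or_imp]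
    refine ⟨⟨_, R.mul_mem hx hw.1⟩, ?_⟩
    rintro _ ⟨z, hz, rfl⟩
    exact ⟨_, hw.2 z hz⟩

lemma barMul_comp (f : X →ₗ[k] Y) (ψ : List R.A → X) (φ : List R.A → Y)
    (w : List (Γ × R.A)) (hw : ∀ y ∈ w, y.2 ∈ R.deg y.1)
    (h : ∀ u : List R.A, u.length + 1 = w.length → (∀ a ∈ u, ∃ γ, a ∈ R.deg γ) →
      f (ψ u) = φ u) :
    f (barMul R ψ w) = barMul R φ w := by
  induction w generalizing ψ φ with
  | nil => exact map_zero f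
  | cons x w ih =>
    simp only [List.mem_cons, forall_eq_or_imp] at hw
    rw [barMul, barMul, map_smul, map_add, barMulHead_comp f ψ φ x w hw.1 hw.2 fun u hu hq =>
      h u (by simp [hu]) hq]
    congr 2
    refine ih _ _ hw.2 fun u hu hq => h _ (by simp [hu]) ?_
    simpa using ⟨⟨_, hw.1⟩, hq⟩

lemma barD_comp (f : X →ₗ[k] Y) (ψ : List R.A → X) (φ : List R.A → Y)
    (w : List (Γ × R.A)) (hw : ∀ y ∈ w, y.2 ∈ R.deg y.1)
    (h : ∀ u : List R.A, u.length = w.length → (∀ a ∈ u, ∃ γ, a ∈ R.deg γ) →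
      f (ψ u) = φ u) :
    f (barD R ψ w) = barD R φ w := by
  induction w generalizing ψ φ with
  | nil => exact map_zero f
  | cons x w ih =>
    simp only [List.mem_cons, forall_eq_or_imp] at hw
    rw [barD, barD, map_sub, map_smul]
    congr 1
    · congr 1
      refine ih _ _ hw.2 fun u hu hq => h _ (by simp [hu]) ?_
      simpa using ⟨⟨_, hw.1⟩, hq⟩
    · refine h _ (by simp) ?_
      simp only [List.mem_cons, List.mem_map, forall_eq_or_imp]
      refine ⟨⟨_, R.d_deg hw.1⟩, ?_⟩
      rintro _ ⟨z, hz, rfl⟩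
      exact ⟨_, hw.2 z hz⟩

lemma barH_comp (f : X →ₗ[k] Y) (ψ : List R.A → X) (φ : List R.A → Y)
    (w : List (Γ × R.A)) (hw : ∀ y ∈ w, y.2 ∈ R.deg y.1)
    (h : ∀ u : List R.A, u.length = w.length + 1 → (∀ a ∈ u, ∃ γ, a ∈ R.deg γ) →
      f (ψ u) = φ u) :
    f (barH R ψ w) = barH R φ w := by
  induction w generalizing ψ φ with
  | nil => exact h _ rfl (by simpa using ⟨_, R.h_deg⟩)
  | cons x w ih =>
    simp only [List.mem_cons, forall_eq_or_imp] at hw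
    rw [barH, barH, map_add, map_smul]
    congr 1
    · congr 1
      refine ih _ _ hw.2 fun u hu hq => h _ (by simp [hu]) ?_
      simpa using ⟨⟨_, hw.1⟩, hq⟩
    · refine h _ (by simp) ?_
      simp only [List.mem_cons, List.mem_map, forall_eq_or_imp]
      refine ⟨⟨_, R.h_deg⟩, ⟨_, hw.1⟩, ?_⟩
      rintro _ ⟨z, hz, rfl⟩
      exact ⟨_, hw.2 z hz⟩

lemma barCyc_comp (f : X →ₗ[k] Y) (ψ : List R.A → X) (φ : List R.A → Y) (x : Γ × R.A)
    (w : List (Γ × R.A)) (hx : x.2 ∈ R.deg x.1) (hw : ∀ y ∈ w, y.2 ∈ R.deg y.1)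
    (h : ∀ u : List R.A, u.length = w.length → (∀ a ∈ u, ∃ γ, a ∈ R.deg γ) → f (ψ u) = φ u) :
    f (barCyc R ψ x w) = barCyc R φ x w := by
  rcases List.eq_nil_or_concat' w with rfl | ⟨w, y, rfl⟩
  · exact map_zero f
  · rw [barCyc_append, barCyc_append, map_smul, h _ (by simp)]
    simp only [List.mem_cons, List.mem_map, forall_eq_or_imp]
    refine ⟨⟨_, R.mul_mem (hw y (by simp)) hx⟩, ?_⟩
    rintro _ ⟨z, hz, rfl⟩
    exact ⟨_, hw z (by simp [hz])⟩

lemma hochMul_comp (f : X →ₗ[k] Y) (ψ : List R.A → X) (φ : List R.A → Y) (x : Γ × R.A)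
    (w : List (Γ × R.A)) (hL : ∀ y ∈ x :: w, y.2 ∈ R.deg y.1)
    (h : ∀ u : List R.A, u.length = w.length → (∀ a ∈ u, ∃ γ, a ∈ R.deg γ) → f (ψ u) = φ u) :
    f (hochMul R ψ x w) = hochMul R φ x w := by
  rw [hochMul, hochMul, map_sub, map_neg,
    barMul_comp f ψ φ _ hL fun u hu => h u (by simpa using hu)]
  simp only [List.mem_cons, forall_eq_or_imp] at hL
  rw [barCyc_comp f ψ φ x w hL.1 hL.2 h]

lemma hochD_comp (f : X →ₗ[k] Y) (ψ : List R.A → X) (φ : List R.A → Y) (x : Γ × R.A)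
    (w : List (Γ × R.A)) (hL : ∀ y ∈ x :: w, y.2 ∈ R.deg y.1)
    (h : ∀ u : List R.A, u.length = w.length + 1 → (∀ a ∈ u, ∃ γ, a ∈ R.deg γ) →
      f (ψ u) = φ u) :
    f (hochD R ψ x w) = hochD R φ x w := by
  rw [hochD, hochD, map_neg, barD_comp f ψ φ _ hL h]

lemma hochH_comp (f : X →ₗ[k] Y) (ψ : List R.A → X) (φ : List R.A → Y) (x : Γ × R.A)
    (w : List (Γ × R.A)) (hL : ∀ y ∈ x :: w, y.2 ∈ R.deg y.1)
    (h : ∀ u : List R.A, u.length = w.length + 2 → (∀ a ∈ u, ∃ γ, a ∈ R.deg γ) →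
      f (ψ u) = φ u) :
    f (hochH R ψ x w) = hochH R φ x w := by
  simp only [List.mem_cons, forall_eq_or_imp] at hL
  rw [hochH, hochH, map_neg, map_smul, barH_comp f _ (fun u => φ (x.2 :: u)) w hL.2]
  refine fun u hu hq => h _ (by simp [hu]) ?_
  simpa using ⟨⟨_, hL.1⟩, hq⟩

lemma connesSum_comp (f : X →ₗ[k] Y) (ψ : List R.A → X) (φ : List R.A → Y) (x : Γ × R.A)
    (w : List (Γ × R.A)) (hL : ∀ y ∈ x :: w, y.2 ∈ R.deg y.1)
    (h : ∀ u : List R.A, u.length = w.length + 2 → (∀ a ∈ u, ∃ γ, a ∈ R.deg γ) →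
      f (ψ u) = φ u) :
    f (connesSum R ψ x w) = connesSum R φ x w := by
  simp only [List.mem_cons, forall_eq_or_imp] at hL
  refine (splitSum_comp f.toAddMonoidHom _ w).trans (splitSum_congr _ _ _ fun u v huv => ?_)
  subst huv
  simp only [LinearMap.toAddMonoidHom_coe, map_smul]
  rw [h _ (by simp; omega)]
  simp only [List.mem_cons, List.mem_append, List.mem_map]
  rintro a (rfl | ⟨z, hz, rfl⟩ | rfl | ⟨z, hz, rfl⟩)
  · exact ⟨_, R.one_mem⟩
  · exact ⟨_, hL.2 z (by simp [hz])⟩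
  · exact ⟨_, hL.1⟩
  · exact ⟨_, hL.2 z (by simp [hz])⟩

end Naturality

section Intertwining

variable {R' : CurvedDGA k Γ} {H : RedAlgHochParts k Γ R} {H' : RedAlgHochParts k Γ R'}
  {ρ : R.A →ₐ[k] R'.A} {β : R'.A} {F : (n m : ℕ) → H.W n →ₗ[k] H'.W m}
  {X : Type} [AddCommGroup X] [Module k X]

lemma exists_labelling (l : List R.A) (hl : ∀ a ∈ l, ∃ γ, a ∈ R.deg γ) :
    ∃ L : List (Γ × R.A), L.map Prod.snd = l ∧ ∀ y ∈ L, y.2 ∈ R.deg y.1 := by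
  induction l with
  | nil => exact ⟨[], by simp⟩
  | cons a l ih =>
    simp only [List.mem_cons, forall_eq_or_imp] at hl
    obtain ⟨⟨γ, hγ⟩, hl⟩ := hl
    obtain ⟨L, rfl, hL⟩ := ih hl
    exact ⟨(γ, a) :: L, by simp, List.forall_mem_cons.2 ⟨hγ, hL⟩⟩

lemma IsInduced.apply_word_of_homogeneous (hF : IsInduced H H' ρ β F) (n m : ℕ) (l : List R.A)
    (hl : l.length = n + 1) (hq : ∀ a ∈ l, ∃ γ, a ∈ R.deg γ) :
    F n m (H.word n l) = headSum β m (H'.word m) (l.map ρ) := by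
  obtain ⟨_ | ⟨x, w⟩, rfl, hL⟩ := exists_labelling l hq
  · simp at hl
  · exact hF.apply_word n m x w (by simpa using hl) hL

/-- Evaluation of a linear map on the image of a word, computed on labelled words. -/
lemma IsInduced.comp_apply_word (hF : IsInduced H H' ρ β F) (h : IsCDGAMorphism R R' ρ β)
    (n m : ℕ) (f : H'.W m →ₗ[k] X) (x : Γ × R.A) (θ : List (Γ × R'.A) → X)
    (hθ : ∀ u : List (Γ × R'.A), u.length = m →
      (∀ y ∈ Prod.map id ρ x :: u, y.2 ∈ R'.deg y.1) →
      f (H'.word m ((Prod.map id ρ x :: u).map Prod.snd)) = θ u)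
    (w : List (Γ × R.A)) (hw : w.length = n) (hL : ∀ y ∈ x :: w, y.2 ∈ R.deg y.1) :
    f (F n m (H.word n ((x :: w).map Prod.snd))) =
      insSum ((1 : Γ), β) m θ (w.map (Prod.map id ρ)) := by
  simp only [List.mem_cons, forall_eq_or_imp] at hL
  rw [hF.apply_word n m x w hw (by simpa using hL), List.map_cons, List.map_cons, headSum,
    ← map_snd_map, ← insSum_map_snd ((1 : Γ), β) m (fun u => H'.word m (ρ x.2 :: u))]
  refine (insSum_comp _ f.toAddMonoidHom _ _ _).symm.trans ?_
  refine insSum_congr _ (fun y => y.2 ∈ R'.deg y.1) h.deg_one (fun _ => (0 : ℕ)) rfl m _ _ _ ?_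
    fun u hu hq _ => hθ u hu ?_
  · simp only [List.mem_map]
    rintro _ ⟨y, hy, rfl⟩
    exact h.map_deg (hL.2 y hy)
  · simp only [List.mem_cons, forall_eq_or_imp]
    exact ⟨h.map_deg hL.1, hq⟩

/-- Precomposition of a family of linear maps with the multiplicative part of `b`. -/
def compB2 (H : RedAlgHochParts k Γ R) (f : (n : ℕ) → H.W n →ₗ[k] X) :
    (n : ℕ) → H.W n →ₗ[k] X
  | 0 => 0
  | n + 1 => f n ∘ₗ H.b2 n

/-- Postcomposition of a family of linear maps with the curvature part of `b`. -/
def b0Comp (H : RedAlgHochParts k Γ R) (f : (n : ℕ) → X →ₗ[k] H.W n) :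
    (n : ℕ) → X →ₗ[k] H.W n
  | 0 => 0
  | n + 1 => H.b0 n ∘ₗ f n

/-- The induced map commutes with `b`, in weight components. -/
theorem IsInduced.comm_b (hF : IsInduced H H' ρ β F) (h : IsCDGAMorphism R R' ρ β) (n m : ℕ) :
    H.compB2 (fun i => F i m) n + F n m ∘ₗ H.b1 n + F (n + 1) m ∘ₗ H.b0 n =
      H'.b2 m ∘ₗ F n (m + 1) + H'.b1 m ∘ₗ F n m + H'.b0Comp (F n) m := by
  refine H.hom_ext_word fun x w hw hL => ?_
  have e2 : H.compB2 (fun i => F i m) n (H.word n ((x :: w).map Prod.snd)) =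
      hochMul R (fun u => headSum β m (H'.word m) (u.map ρ)) x w := by
    cases n with
    | zero =>
      obtain rfl := List.length_eq_zero_iff.1 hw
      simp [compB2, hochMul, barMul, barMulHead, barCyc_nil]
    | succ n =>
      rw [compB2, LinearMap.comp_apply, H.b2_word n x w hw hL]
      exact hochMul_comp _ _ _ x w hL fun u hu hq =>
        hF.apply_word_of_homogeneous n m u (by omega) hq
  have e0 : H'.b0Comp (F n) m (H.word n ((x :: w).map Prod.snd)) =
      insSumPred ((1 : Γ), β) m (hochH R' (H'.word m) (Prod.map id ρ x))
        (w.map (Prod.map id ρ)) := by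
    cases m with
    | zero => rfl
    | succ m =>
      exact hF.comp_apply_word h n m (H'.b0 m) x _ (fun u hu hq => H'.b0_word m _ u hu hq)
        w hw hL
  simp only [LinearMap.add_apply, LinearMap.comp_apply]
  rw [e2, e0, H.b1_word n x w hw hL, H.b0_word n x w hw hL,
    hochD_comp (F n m) _ (fun u => headSum β m (H'.word m) (u.map ρ)) x w hL fun u hu hq =>
      hF.apply_word_of_homogeneous n m u (by omega) hq,
    hochH_comp (F (n + 1) m) _ (fun u => headSum β m (H'.word m) (u.map ρ)) x w hL
      fun u hu hq => hF.apply_word_of_homogeneous (n + 1) m u (by omega) hq,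
    hF.comp_apply_word h n (m + 1) (H'.b2 m) x _ (fun u hu hq => H'.b2_word m _ u hu hq) w hw hL,
    hF.comp_apply_word h n m (H'.b1 m) x _ (fun u hu hq => H'.b1_word m _ u hu hq) w hw hL]
  exact (h.insSum_hoch (H'.isMultilinear_word m) m x w hL).symm

/-- The induced map commutes with `B`, in weight components. -/
theorem IsInduced.comm_Bop (hF : IsInduced H H' ρ β F) (h : IsCDGAMorphism R R' ρ β)
    (n m : ℕ) : F (n + 1) (m + 1) ∘ₗ H.Bop n = H'.Bop m ∘ₗ F n m := by
  refine H.hom_ext_word fun x w hw hL => ?_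
  rw [LinearMap.comp_apply, LinearMap.comp_apply, H.Bop_word n x w hw hL,
    connesSum_comp (F (n + 1) (m + 1)) _
      (fun u => headSum β (m + 1) (H'.word (m + 1)) (u.map ρ)) x w hL
      fun u hu hq => hF.apply_word_of_homogeneous (n + 1) (m + 1) u (by omega) hq,
    hF.comp_apply_word h n m (H'.Bop m) x _ (fun u hu hq => H'.Bop_word m _ u hu hq) w hw hL]
  exact (insSum_connesSum _ m x w).symm

theorem IsInduced.map_bTot (hF : IsInduced H H' ρ β F) (h : IsCDGAMorphism R R' ρ β)
    (x : ∀ n, H.W n) (m : ℕ) :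
    ∑ n ∈ range (m + 1), F n m (H.bTot x n) =
      H'.bTot (fun m => ∑ n ∈ range (m + 1), F n m (x n)) m := by
  have key := Finset.sum_congr (rfl : range (m + 2) = range (m + 2)) fun n _ =>
    LinearMap.congr_fun (hF.comm_b h n m) (x n)
  simp only [LinearMap.add_apply, LinearMap.comp_apply, Finset.sum_add_distrib] at key
  have z₁ : F (m + 1) m = 0 := hF.zero (by omega)
  have z₂ : F (m + 2) m = 0 := hF.zero (by omega)
  have l₂ : ∑ n ∈ range (m + 2), H.compB2 (fun i => F i m) n (x n) =
      ∑ n ∈ range (m + 1), F n m (H.b2 n (x (n + 1))) := by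
    rw [Finset.sum_range_succ']
    simp [compB2]
  have l₁ : ∑ n ∈ range (m + 2), F n m (H.b1 n (x n)) =
      ∑ n ∈ range (m + 1), F n m (H.b1 n (x n)) := by
    rw [Finset.sum_range_succ, z₁, LinearMap.zero_apply, add_zero]
  have r₁ : ∑ n ∈ range (m + 2), H'.b1 m (F n m (x n)) =
      ∑ n ∈ range (m + 1), H'.b1 m (F n m (x n)) := by
    rw [Finset.sum_range_succ, z₁, LinearMap.zero_apply, map_zero, add_zero]
  have l₀ : ∑ n ∈ range (m + 2), F (n + 1) m (H.b0 n (x n)) =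
      ∑ n ∈ range m, F (n + 1) m (H.b0 n (x n)) := by
    rw [Finset.sum_range_succ, Finset.sum_range_succ, z₁, z₂]
    simp
  rw [l₂, l₁, l₀, r₁, ← map_sum, ← map_sum] at key
  unfold bTot
  simp only [map_add, Finset.sum_add_distrib]
  rw [Finset.sum_range_succ' (fun n => F n m (match n with
      | 0 => 0
      | i + 1 => H.b0 i (x i) : H.W n)), map_zero, add_zero]
  refine key.trans (congrArg _ ?_)
  cases m with
  | zero => simp [b0Comp]
  | succ m =>
    rw [Finset.sum_range_succ, Finset.sum_range_succ]
    simp [b0Comp, hF.zero (show m < m + 1 by omega), hF.zero (show m < m + 1 + 1 by omega)]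

theorem IsInduced.map_BTot (hF : IsInduced H H' ρ β F) (h : IsCDGAMorphism R R' ρ β)
    (x : ∀ n, H.W n) (m : ℕ) :
    ∑ n ∈ range (m + 1), F n m (H.BTot x n) =
      H'.BTot (fun m => ∑ n ∈ range (m + 1), F n m (x n)) m := by
  rw [Finset.sum_range_succ']
  cases m with
  | zero => simp [BTot]
  | succ m =>
    simp only [BTot, map_zero, add_zero, map_sum]
    exact Finset.sum_congr rfl fun n _ => LinearMap.congr_fun (hF.comm_Bop h n m) (x n)

end Intertwining

end RedAlgHochParts

/-- Let `(ρ, β) : (A, d, h) → (A', d', h')` be a morphism of curved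
differential `Γ`-graded algebras over a field `k`.  Then the induced map `(ρ,β)_*`
on reduced Hochschild complexes of the second kind, given by
`(ρ,β)_*(a₀[ā₁|⋯|āₙ]) = ∑ (−1)^{i₀+⋯+iₙ} ρ(a₀)[β̄^{i₀}|ρ(a₁)̄|⋯|ρ(aₙ)̄|β̄^{iₙ}]`,
commutes with both the Hochschild differential `b` and the Connes operator `B`, i.e.
it is a morphism of mixed complexes
`(H̄och^{II}(A,d,h), b, B) → (H̄och^{II}(A',d',h'), b, B)`.  (When `β = 0` the map
preserves finitely supported families, so the same identities give a morphism of the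
direct-sum reduced complexes `(H̄och(A,d,h), b, B) → (H̄och(A',d',h'), b, B)`.)
Here `F n m` is the component of `(ρ,β)_*` from weight `n` to weight `m`, and the
total maps on `∏ₙ Wₙ` are compared componentwise. -/
theorem cdga_morphism_induces_mixed_complex_morphism
    (k Γ : Type) [Field k] [GradingGroup Γ]
    (R R' : CurvedDGA k Γ)
    (H : RedAlgHochParts k Γ R) (H' : RedAlgHochParts k Γ R')
    -- the morphism `(ρ, β)` of cdga's:
    (ρ : R.A →ₐ[k] R'.A) (β : R'.A)
    (ρ_deg : ∀ {γ : Γ} {a : R.A}, a ∈ R.deg γ → ρ a ∈ R'.deg γ)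
    (β_deg : β ∈ R'.deg 1)
    (ρ_d : ∀ {γ : Γ} {a : R.A}, a ∈ R.deg γ →
      ρ (R.d a) - R'.d (ρ a) = β * ρ a - gsign k γ • (ρ a * β))
    (ρ_h : ρ R.hEl = R'.hEl + R'.d β + β * β)
    -- the induced map `(ρ, β)_*`, in weight components:
    (F : (n m : ℕ) → H.W n →ₗ[k] H'.W m)
    (F_zero : ∀ {n m : ℕ}, m < n → F n m = 0)
    (F_gen : ∀ (n m : ℕ), n ≤ m → ∀ (a : ℕ → R.A) (g : ℕ → Γ), R.Homog n g a →
      F n m (H.gen n a) = ((-1 : k) ^ (m - n)) •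
        ∑ v ∈ Finset.Nat.antidiagonalTuple (n + 1) (m - n),
          H'.gen m (interleave β (fun i => ρ (a i)) (extTuple v) n)) :
    -- `(ρ,β)_*` commutes with `b` and with `B`:
    (∀ x : ∀ n, H.W n,
      (fun m => ∑ n ∈ Finset.range (m + 1), F n m (H.bTot x n)) =
        H'.bTot (fun m => ∑ n ∈ Finset.range (m + 1), F n m (x n))) ∧
    (∀ x : ∀ n, H.W n,
      (fun m => ∑ n ∈ Finset.range (m + 1), F n m (H.BTot x n)) =
        H'.BTot (fun m => ∑ n ∈ Finset.range (m + 1), F n m (x n))) := by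
  have h : RedAlgHochParts.IsCDGAMorphism R R' ρ β := ⟨ρ_deg, β_deg, ρ_d, ρ_h⟩
  have hF : RedAlgHochParts.IsInduced H H' ρ β F := ⟨F_zero, F_gen⟩
  exact ⟨fun x => funext fun m => hF.map_bTot h x m, fun x => funext fun m => hF.map_BTot h x m⟩

end
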